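/- arXiv:1907.08122 — 9 statements merged into one kernel-verified Lean document; each statement's English description precedes it below -/
import Mathlib

section
/- Let q be a prime power and let c ∈ F_{q^6} satisfy c^2 + c = 1. Then the following are equivalent: (i) for every pair (α, β) ∈ F_{q^6} × F_{q^6} with (α, β) ≠ (0, 0), the set {x ∈ F_{q^6} : α·x + β·x^q + β·x^{q^3} + c·β·x^{q^5} = 0} has at most q elements; (ii) q is odd. (This says that the F_{q^6}-span of the maps x ↦ x and x ↦ x^q + x^{q^3} + c·x^{q^5} is an F_q-linear MRD-code of dimension 12 and minimum distance 5 if and only if q is odd.) -/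
theorem cross_minor_eq_zero {F : Type*} [Field F] {a₀ a₁ a₂ b₀ b₁ b₂ x₀ x₁ x₂ y₀ y₁ y₂ : F}
    (hax : a₀ * x₀ + a₁ * x₁ + a₂ * x₂ = 0) (hay : a₀ * y₀ + a₁ * y₁ + a₂ * y₂ = 0)
    (hbx : b₀ * x₀ + b₁ * x₁ + b₂ * x₂ = 0) (hby : b₀ * y₀ + b₁ * y₁ + b₂ * y₂ = 0)
    (hw : x₀ * y₂ - x₂ * y₀ ≠ 0) : a₀ * b₁ - a₁ * b₀ = 0 := by
  have ha : a₀ * (x₀ * y₂ - x₂ * y₀) = a₁ * (x₂ * y₁ - x₁ * y₂) := by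
    linear_combination y₂ * hax - x₂ * hay
  have hb : b₀ * (x₀ * y₂ - x₂ * y₀) = b₁ * (x₂ * y₁ - x₁ * y₂) := by
    linear_combination y₂ * hbx - x₂ * hby
  refine (mul_eq_zero.mp ?_).resolve_right hw
  linear_combination b₁ * ha - a₁ * hb

/-- The vanishing of two minors is contradictory when `c` is fixed by `σ`. -/
theorem minors_false_of_fixed {F : Type*} [Field F] (h2 : (2 : F) ≠ 0) (σ : F →+* F)
    {c m₀ m₁ m₂ m₃ m₄ m₅ : F} (hc : c ^ 2 + c = 1) (hσc : σ c = c)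
    (h₀ : σ m₀ = m₁) (h₁ : σ m₁ = m₂) (h₂ : σ m₂ = m₃) (h₃ : σ m₃ = m₄) (h₄ : σ m₄ = m₅)
    (h₅ : σ m₅ = m₀)
    (E : (1 + c) * (m₁ * m₂ * m₃ * m₄) + (1 + c) * (m₁ * m₂ + m₃ * m₄) + c * (m₁ * m₄)
      + m₂ * m₃ + 1 - c = 0)
    (G : (2 + c) * (m₀ * m₁ * m₂ * m₃) - c * (m₀ * m₁ + m₂ * m₃) + m₀ * m₃
      - (1 + c) * (m₁ * m₂) + c ^ 2 - 1 = 0) : False := by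
  have hc0 : c ≠ 0 := by rintro rfl; simp at hc
  have G' := congrArg σ G
  simp only [map_add, map_sub, map_mul, map_pow, map_one, map_zero, map_ofNat, hσc, h₀, h₁, h₂,
    h₃] at G'
  have S1 : m₁ * m₂ + m₂ * m₃ + m₃ * m₄ = -c ^ 2 := by
    apply mul_left_cancel₀ h2
    linear_combination E - c * G' + (m₁ * m₂ * m₃ * m₄ - m₁ * m₂ - m₃ * m₄ - m₂ * m₃ + 1 + c) * hc
  have S2 := congrArg σ S1
  simp only [map_add, map_neg, map_mul, map_pow, hσc, h₁, h₂, h₃, h₄] at S2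
  have S3 := congrArg σ S2
  simp only [map_add, map_neg, map_mul, map_pow, hσc, h₂, h₃, h₄, h₅] at S3
  have S4 := congrArg σ S3
  simp only [map_add, map_neg, map_mul, map_pow, hσc, h₀, h₃, h₄, h₅] at S4
  have P5 : m₅ * m₀ = m₂ * m₃ := by linear_combination S3 - S2
  have P0 : m₀ * m₁ = m₃ * m₄ := by linear_combination S4 - S3
  have E5 := congrArg σ (congrArg σ (congrArg σ (congrArg σ (congrArg σ E))))
  simp only [map_add, map_sub, map_mul, map_one, map_zero, hσc, h₀, h₁, h₂,
    h₃, h₄, h₅] at E5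
  have T1 : m₁ * m₄ = -(m₀ * m₁) - m₁ * m₂ - (2 + c) * (m₀ * m₁ * (m₁ * m₂)) := by
    have X : m₁ * m₂ * m₃ * m₄ = m₀ * m₁ * (m₁ * m₂) := by rw [P0]; ring
    rw [X] at E
    clear E5 S2 S3 S4 G G'
    generalize m₁ * m₄ = t at *
    generalize m₀ * m₁ = p₀ at *
    generalize m₁ * m₂ = p₁ at *
    generalize m₂ * m₃ = p₂ at *
    generalize m₃ * m₄ = p₃ at *
    subst P0
    grind
  have T0 : m₀ * m₃ = -(m₀ * m₁) - m₂ * m₃ - (2 + c) * (m₀ * m₁ * (m₂ * m₃)) := by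
    have X : m₀ * m₁ * m₂ * m₃ = m₀ * m₁ * (m₂ * m₃) := by ring
    rw [X] at E5
    clear E S2 S3 S4 G G'
    generalize m₀ * m₃ = t at *
    generalize m₀ * m₁ = p₀ at *
    generalize m₁ * m₂ = p₁ at *
    generalize m₂ * m₃ = p₂ at *
    generalize m₃ * m₄ = p₃ at *
    subst P0
    grind
  have TT : m₁ * m₄ * (m₀ * m₃) = m₀ * m₁ * (m₀ * m₁) := by
    nth_rewrite 2 [P0]; ring
  have key : (1 + (2 + c) * (m₀ * m₁)) * ((1 + (2 + c) * (m₀ * m₁)) *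
      ((1 + (2 + c) * (m₁ * m₂)) * (1 + (2 + c) * (m₂ * m₃)))) = 0 := by
    rw [T1, T0] at TT
    rw [← P0] at S1
    clear E E5 S2 S3 S4 G G' T1 T0 P5 P0
    generalize m₀ * m₁ = p₀ at *
    generalize m₁ * m₂ = p₁ at *
    generalize m₂ * m₃ = p₂ at *
    grind
  have hp₂ : (1 + (2 + c) * (m₂ * m₃)) = 0 → False := by
    intro Q2
    have Q3 := congrArg σ Q2
    simp only [map_add, map_mul, map_one, map_zero, map_ofNat, hσc, h₂, h₃] at Q3
    have Q4 := congrArg σ Q3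
    simp only [map_add, map_mul, map_one, map_zero, map_ofNat, hσc, h₃, h₄] at Q4
    have : 2 * c ^ 2 = 0 := by
      clear E E5 S1 S3 S4 G G' T1 T0 P5 P0
      generalize m₄ * m₅ = p₀ at *
      generalize m₃ * m₄ = p₁ at *
      generalize m₂ * m₃ = p₂ at *
      grind
    exact mul_ne_zero h2 (pow_ne_zero 2 hc0) this
  have hp₁ : (1 + (2 + c) * (m₁ * m₂)) = 0 → False := by
    intro Q
    apply hp₂
    simpa only [map_add, map_mul, map_one, map_zero, map_ofNat, hσc, h₁, h₂] using congrArg σ Q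
  have hp₀ : (1 + (2 + c) * (m₀ * m₁)) = 0 → False := by
    intro Q
    apply hp₁
    simpa only [map_add, map_mul, map_one, map_zero, map_ofNat, hσc, h₀, h₁] using congrArg σ Q
  rcases mul_eq_zero.mp key with Q | Q
  · exact hp₀ Q
  rcases mul_eq_zero.mp Q with Q | Q
  · exact hp₀ Q
  rcases mul_eq_zero.mp Q with Q | Q
  · exact hp₁ Q
  · exact hp₂ Q

/-- The vanishing of three minors is contradictory when `σ` conjugates `c`. -/
theorem minors_false_of_not_fixed {F : Type*} [Field F] (h2 : (2 : F) ≠ 0) (σ : F →+* F)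
    {c m₀ m₁ m₂ m₃ m₄ m₅ : F} (hc : c ^ 2 + c = 1) (hσc : σ c = -1 - c)
    (h₀ : σ m₀ = m₁) (h₁ : σ m₁ = m₂) (h₂ : σ m₂ = m₃) (h₃ : σ m₃ = m₄) (h₄ : σ m₄ = m₅)
    (h₅ : σ m₅ = m₀)
    (E : (1 + c) * (m₁ * m₂ * m₃ * m₄) + (1 + c) * (m₁ * m₂ + m₃ * m₄) + (-1 - c) * (m₁ * m₄)
      + m₂ * m₃ + 1 - (-1 - c) = 0)
    (G : (2 + c) * (m₀ * m₁ * m₂ * m₃) - (-1 - c) * (m₀ * m₁ + m₂ * m₃) + m₀ * m₃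
      - (1 + c) * (m₁ * m₂) + (-1 - c) ^ 2 - 1 = 0)
    (T : (2 + c) * (m₀ * m₁ * m₃ * m₄) + m₀ * m₁ - (-1 - c) * (1 + c) * (m₃ * m₄) - (-1 - c)
      - m₁ * m₄ - m₀ * m₃ + 1 = 0) : False := by
  have h4 : (4 : F) ≠ 0 := by
    have : (4 : F) = 2 * 2 := by norm_num
    rw [this]; exact mul_ne_zero h2 h2
  have h8 : (8 : F) ≠ 0 := by
    have : (8 : F) = 2 * 4 := by norm_num
    rw [this]; exact mul_ne_zero h2 h4
  have G' := congrArg σ G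
  simp only [map_add, map_sub, map_mul, map_pow, map_neg, map_one, map_zero, map_ofNat, hσc,
    h₀, h₁, h₂, h₃] at G'
  have S : (m₁ * m₄ + 1) * (m₂ * m₃ + c ^ 2) = 0 := by
    grind
  rcases mul_eq_zero.mp S with Z | W
  · have Z' := congrArg σ (congrArg σ Z)
    simp only [map_add, map_mul, map_one, map_zero, h₁, h₂, h₄, h₅] at Z'
    have Z'' : m₀ * m₃ + 1 = 0 := by linear_combination Z'
    have hp : m₀ * m₁ * (m₃ * m₄) = 1 := by grind
    have Q : (m₀ * m₁ - (c - 1)) * (m₀ * m₁ + 3 * c + 5) = 0 := by grind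
    rcases mul_eq_zero.mp Q with Q | Q
    · have Q1 := congrArg σ Q
      simp only [map_sub, map_mul, map_one, map_zero, hσc, h₀, h₁] at Q1
      have Q2 := congrArg σ Q1
      simp only [map_sub, map_neg, map_mul, map_one, map_zero, hσc, h₂, h₁] at Q2
      have Q3 := congrArg σ Q2
      simp only [map_sub, map_neg, map_mul, map_one, map_zero, hσc, h₂, h₃] at Q3
      grind
    · have Q1 := congrArg σ Q
      simp only [map_add, map_mul, map_zero, map_ofNat, hσc, h₀, h₁] at Q1
      have Q2 := congrArg σ Q1
      simp only [map_add, map_sub, map_neg, map_mul, map_one, map_zero, map_ofNat, hσc, h₂,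
        h₁] at Q2
      have Q3 := congrArg σ Q2
      simp only [map_add, map_sub, map_neg, map_mul, map_one, map_zero, map_ofNat, hσc, h₂,
        h₃] at Q3
      grind
  · have hd : (1 + c) * c = 1 := by linear_combination hc
    have hd0 : (1 + c) ≠ 0 := left_ne_zero_of_mul_eq_one hd
    have W' : m₂ * m₃ = -c ^ 2 := by linear_combination W
    have W3 := congrArg σ W'
    simp only [map_pow, map_mul, map_neg, hσc, h₂, h₃] at W3
    have W5 := congrArg σ (congrArg σ (congrArg σ (congrArg σ W3)))
    simp only [map_sub, map_neg, map_pow, map_mul, map_one, hσc, h₃, h₄, h₅, h₀, h₁] at W5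
    have W1 : m₁ * m₂ = -(1 + c) ^ 2 := by rw [W5]; ring
    have X : m₁ * m₂ * m₃ * m₄ = (1 + c) ^ 4 := by rw [W1, mul_assoc, W3]; ring
    have X' : m₁ * m₄ * c ^ 2 = -(1 + c) ^ 4 := by
      linear_combination -X + m₁ * m₄ * W
    rw [X, W1, W3, W'] at E
    have t : m₁ * m₄ = 3 := by
      apply mul_left_cancel₀ hd0
      clear X X' G G' T S W W' W1 W3 W5
      generalize m₁ * m₄ = t at *
      grind
    rw [t] at X'
    have : 8 * (1 + c) = 0 := by clear E G G' T S W W' W1 W3 W5; grind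
    exact mul_ne_zero h8 hd0 this

/-- Elimination of the odd conjugates of `x` from the conjugates of `m x = f(x)`. -/
theorem even_conjugates_relations {F : Type*} [Field F]
    {c c' m₀ m₁ m₂ m₃ m₄ x₀ x₁ x₂ x₃ x₄ x₅ : F} (hc : c ^ 2 + c = 1)
    (R₀ : m₀ * x₀ = x₁ + x₃ + c * x₅) (R₁ : m₁ * x₁ = x₂ + x₄ + c' * x₀)
    (R₂ : m₂ * x₂ = x₃ + x₅ + c * x₁) (R₃ : m₃ * x₃ = x₄ + x₀ + c' * x₂)
    (R₄ : m₄ * x₄ = x₅ + x₁ + c * x₃) :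
    x₁ = m₀ * x₀ - (1 + c) * m₂ * x₂ + m₄ * x₄ ∧
    (m₀ * m₁ - c') * x₀ + (-(1 + c) * (m₁ * m₂) - 1) * x₂ + (m₁ * m₄ - 1) * x₄ = 0 ∧
    (m₀ * m₃ - 1) * x₀ + (m₂ * m₃ - c') * x₂ + (-(1 + c) * (m₃ * m₄) - 1) * x₄ = 0 := by
  have h₁ : x₁ = m₀ * x₀ - (1 + c) * m₂ * x₂ + m₄ * x₄ := by
    linear_combination x₁ * hc - R₀ + (1 + c) * R₂ - R₄
  have h₃ : x₃ = m₀ * x₀ + m₂ * x₂ - (1 + c) * m₄ * x₄ := by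
    linear_combination x₃ * hc - R₀ - R₂ + (1 + c) * R₄
  refine ⟨h₁, ?_, ?_⟩
  · linear_combination R₁ - m₁ * h₁
  · linear_combination R₃ - m₃ * h₃

theorem frobenius_ratio_fixed {F : Type*} [Field F] (h2 : (2 : F) ≠ 0) (σ : F →+* F)
    (hσ : ∀ x, σ (σ (σ (σ (σ (σ x))))) = x) {c m x y : F} (hc : c ^ 2 + c = 1) (hx0 : x ≠ 0)
    (hx : m * x = σ x + σ (σ (σ x)) + c * σ (σ (σ (σ (σ x)))))
    (hy : m * y = σ y + σ (σ (σ y)) + c * σ (σ (σ (σ (σ y))))) :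
    σ y * x = y * σ x := by
  have hc' : σ c = c ∨ σ c = -1 - c := by
    have h := congrArg σ hc
    simp only [map_add, map_pow, map_one] at h
    have : (σ c - c) * (σ c - (-1 - c)) = 0 := by linear_combination h - hc
    rcases mul_eq_zero.mp this with h | h
    · exact Or.inl (sub_eq_zero.mp h)
    · exact Or.inr (sub_eq_zero.mp h)
  have hcc : σ (σ c) = c := by
    rcases hc' with h | h
    · rw [h, h]
    · rw [h, map_sub, map_neg, map_one, h]; ring
  have conj : ∀ z, m * z = σ z + σ (σ (σ z)) + c * σ (σ (σ (σ (σ z)))) →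
      _ := fun z R₀ => by
    have R₁ := congrArg σ R₀
    simp only [map_add, map_mul, hσ] at R₁
    have R₂ := congrArg σ R₁
    simp only [map_add, map_mul, hcc] at R₂
    have R₃ := congrArg σ R₂
    simp only [map_add, map_mul, hσ] at R₃
    have R₄ := congrArg σ R₃
    simp only [map_add, map_mul, hcc] at R₄
    exact even_conjugates_relations hc R₀ R₁ R₂ R₃ R₄
  obtain ⟨x₁, xa, xb⟩ := conj x hx
  obtain ⟨y₁, ya, yb⟩ := conj y hy
  by_cases w : x * σ (σ y) - σ (σ x) * y = 0
  · obtain ⟨l, rfl⟩ : ∃ l, y = l * x := ⟨y / x, by field_simp⟩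
    have hx2 : σ (σ x) ≠ 0 := by simpa using hx0
    have hl : σ (σ l) = l := by
      apply mul_right_cancel₀ (mul_ne_zero hx2 hx0)
      simp only [map_mul] at w
      linear_combination w
    simp only [map_mul, hl] at y₁ ⊢
    linear_combination x * y₁ - x * l * x₁
  · exfalso
    have w' : σ (σ x) * y - x * σ (σ y) ≠ 0 := fun h => w (by linear_combination -h)
    have w'' : x * σ (σ (σ (σ y))) - σ (σ (σ (σ x))) * y ≠ 0 := by
      intro h
      have := congrArg σ (congrArg σ h)
      simp only [map_sub, map_mul, hσ, map_zero] at this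
      exact w (by linear_combination -this)
    have E := cross_minor_eq_zero ((add_rotate _ _ _).symm.trans xa)
      ((add_rotate _ _ _).symm.trans ya) ((add_rotate _ _ _).symm.trans xb)
      ((add_rotate _ _ _).symm.trans yb) w'
    have G := cross_minor_eq_zero xa ya xb yb w''
    have T := cross_minor_eq_zero ((add_right_comm _ _ _).trans xa)
      ((add_right_comm _ _ _).trans ya) ((add_right_comm _ _ _).trans xb)
      ((add_right_comm _ _ _).trans yb) w
    rcases hc' with h | h <;> rw [h] at E G T
    · refine minors_false_of_fixed h2 σ hc h rfl rfl rfl rfl rfl (hσ m) ?_ ?_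
      · linear_combination E - (σ m * σ (σ m) * σ (σ (σ m)) * σ (σ (σ (σ m)))) * hc
      · linear_combination G
    · refine minors_false_of_not_fixed h2 σ hc h rfl rfl rfl rfl rfl (hσ m) ?_ ?_ ?_
      · linear_combination E - (σ m * σ (σ m) * σ (σ (σ m)) * σ (σ (σ (σ m)))) * hc
      · linear_combination G
      · linear_combination -T

theorem exists_pow_eq_of_pow_three_eq_one {F : Type*} [Field F] [Fintype F] {n : ℕ}
    (hn : n * 3 ∣ Fintype.card F - 1) {a : F} (ha : a ^ 3 = 1) : ∃ m : F, m ^ n = a := by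
  obtain ⟨g, hg⟩ := IsCyclic.exists_generator (α := Fˣ)
  have ha0 : a ≠ 0 := by rintro rfl; simp at ha
  obtain ⟨k, hk⟩ := (mem_powers_iff_mem_zpowers (x := g)).mpr (hg (Units.mk0 a ha0))
  have hk' : g ^ k = Units.mk0 a ha0 := hk
  have h1 : g ^ (k * 3) = 1 := by
    rw [pow_mul, hk']
    ext
    simpa using ha
  have h2 := orderOf_dvd_of_pow_eq_one h1
  rw [orderOf_eq_card_of_forall_mem_zpowers hg, Nat.card_units, Nat.card_eq_fintype_card] at h2
  obtain ⟨j, rfl⟩ := Nat.dvd_of_mul_dvd_mul_right (by norm_num) (hn.trans h2)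
  refine ⟨(g : F) ^ j, ?_⟩
  have := congrArg Units.val hk'
  rw [← pow_mul, mul_comm]
  simpa using this

open Polynomial in
theorem card_le_mul_ncard_of_linearized {F : Type*} [Field F] [Fintype F] {q : ℕ} (hq : 1 < q)
    (a b e : F) (S : Set F)
    (hS : ∀ y : F, y ^ q ^ 4 + a * y ^ q ^ 3 + b * y ^ q + e * y ∈ S) :
    Fintype.card F ≤ q ^ 4 * S.ncard := by
  classical
  let R : F[X] := C a * X ^ q ^ 3 + C b * X ^ q + C e * X
  have h1 : q ≤ q ^ 3 := Nat.le_self_pow (by norm_num) q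
  have hR : R.natDegree < q ^ 4 := by
    refine lt_of_le_of_lt (b := q ^ 3) ?_ (Nat.pow_lt_pow_right hq (by norm_num))
    refine natDegree_add_le_of_degree_le (natDegree_add_le_of_degree_le ?_ ?_) ?_
    · exact natDegree_C_mul_X_pow_le _ _
    · exact (natDegree_C_mul_X_pow_le _ _).trans h1
    · exact (natDegree_C_mul_le _ _).trans (natDegree_X_le.trans (hq.le.trans h1))
  have hP : (X ^ q ^ 4 + R).natDegree = q ^ 4 := by
    rw [natDegree_add_eq_left_of_natDegree_lt (by rwa [natDegree_X_pow]), natDegree_X_pow]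
  have hpos : 0 < (X ^ q ^ 4 + R).degree :=
    natDegree_pos_iff_degree_pos.mp (by rw [hP]; positivity)
  refine (FiniteField.card_image_polynomial_eval hpos).trans ?_
  rw [hP, ← Set.ncard_coe_finset]
  refine Nat.mul_le_mul_left _ (Set.ncard_le_ncard ?_)
  intro z hz
  obtain ⟨y, -, rfl⟩ := Finset.mem_image.mp (Finset.mem_coe.mp hz)
  have := hS y
  simpa [R, add_assoc] using this

theorem exists_frobenius_ringHom {q : ℕ} (hq : IsPrimePow q) {F : Type*} [Field F] [Fintype F]
    (hcard : Fintype.card F = q ^ 6) : ∃ σ : F →+* F, ∀ x, σ x = x ^ q := by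
  obtain ⟨p, k, hp, hk, rfl⟩ := hq
  have hp' := hp.nat_prime
  have := Fact.mk hp'
  have : CharP F p := by
    apply charP_of_card_eq_prime_pow (f := k * 6)
    rw [hcard, pow_mul]
  exact ⟨iterateFrobenius F p k, fun x => iterateFrobenius_def p k x⟩

open Polynomial in
theorem ncard_pow_eq_self_le {F : Type*} [Field F] {q : ℕ} (hq : 1 < q) :
    {z : F | z ^ q = z}.ncard ≤ q := by
  classical
  have h0 : (X ^ q - X : F[X]) ≠ 0 := FiniteField.X_pow_card_sub_X_ne_zero F hq
  have hS : {z : F | z ^ q = z} = ((X ^ q - X : F[X]).roots.toFinset : Set F) := by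
    ext z
    simp [mem_roots h0, sub_eq_zero]
  rw [hS, Set.ncard_coe_finset]
  refine (Multiset.toFinset_card_le _).trans ((card_roots' _).trans ?_)
  rw [FiniteField.X_pow_card_sub_X_natDegree_eq F hq]

/-- In even characteristic some element of the code annihilates the image of a linearized
polynomial of degree `q ^ 4`. -/
theorem exists_linearized_mem_kernel {F : Type*} [Field F] [Fintype F] {q : ℕ}
    (hcard : Fintype.card F = q ^ 6) (hq : 1 < q) (h2 : (2 : F) = 0) (σ : F →+* F)
    (hσq : ∀ x, σ x = x ^ q) (hσ : ∀ x, σ (σ (σ (σ (σ (σ x))))) = x) {c : F}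
    (hc : c ^ 2 + c = 1) :
    ∃ m a b e : F, ∀ y z : F, z = σ (σ (σ (σ y))) + a * σ (σ (σ y)) + b * σ y + e * y →
      m * z + σ z + σ (σ (σ z)) + c * σ (σ (σ (σ (σ z)))) = 0 := by
  have hc' : σ c = c ∨ σ c = 1 + c := by
    have h := congrArg σ hc
    simp only [map_add, map_pow, map_one] at h
    have : (σ c - c) * (σ c - (1 + c)) = 0 := by
      linear_combination h - hc - (σ c * (1 + c) - c ^ 2 - c) * h2
    rcases mul_eq_zero.mp this with h | h
    · exact Or.inl (sub_eq_zero.mp h)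
    · exact Or.inr (sub_eq_zero.mp h)
  have hc3 : c ^ 3 = 1 := by linear_combination (c - 1) * hc + (c - 1) * h2
  rcases hc' with h | h
  · refine ⟨c, c ^ 2, 1, c ^ 2, fun y z hz => ?_⟩
    simp only [hz, map_add, map_mul, map_pow, map_one, h, hσ]
    grind
  · have hc1 : c ≠ 1 := by
      rintro rfl
      exact one_ne_zero (show (1 : F) = 0 by linear_combination hc)
    have hord : orderOf c = 3 := orderOf_eq_prime hc3 hc1
    have hq1 : 3 ∣ q + 1 := by
      rw [← hord]
      apply orderOf_dvd_of_pow_eq_one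
      rw [pow_succ, ← hσq, h]
      linear_combination hc
    have hdvd : (q + 1) * 3 ∣ Fintype.card F - 1 := by
      obtain ⟨k, hk⟩ := hq1
      have hk' : (q : ℤ) = 3 * k - 1 := by
        have : ((q + 1 : ℕ) : ℤ) = (3 * k : ℕ) := by rw [hk]
        push_cast at this
        linarith
      rw [hcard, ← Int.natCast_dvd_natCast, Nat.cast_sub (Nat.one_le_pow _ _ (by omega))]
      push_cast
      refine ⟨(3 * k ^ 2 - 3 * k + 1) * ((q - 1) * (q ^ 2 + q + 1)), ?_⟩
      rw [hk']
      ring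
    obtain ⟨m, hm⟩ := exists_pow_eq_of_pow_three_eq_one hdvd (a := c ^ 2)
      (by rw [← pow_mul, mul_comm, pow_mul, hc3, one_pow])
    have hm1 : σ m * m = c ^ 2 := by rw [hσq, ← pow_succ, hm]
    refine ⟨m, c * σ m, c ^ 2 * σ m, c, fun y z hz => ?_⟩
    have hc0 : c ≠ 0 := by rintro rfl; simp at hc
    have hs0 : σ m ≠ 0 := by
      intro h0
      rw [h0, zero_mul] at hm1
      exact pow_ne_zero 2 hc0 hm1.symm
    have hm2 : σ (σ m) = c ^ 2 * m := by
      have := congrArg σ hm1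
      simp only [map_mul, map_pow, h] at this
      apply mul_right_cancel₀ hs0
      grind
    simp only [hz, map_add, map_mul, map_pow, map_one, h, hσ, hm2]
    grind

theorem stmt0 (q : ℕ) (hq : IsPrimePow q)
    (F : Type*) [Field F] [Fintype F] (hcard : Fintype.card F = q ^ 6)
    (c : F) (hc : c ^ 2 + c = 1) :
    (∀ α β : F, (α, β) ≠ (0, 0) →
        ({x : F | α * x + β * x ^ q + β * x ^ (q ^ 3) + c * β * x ^ (q ^ 5) = 0} : Set F).ncard ≤ q)
      ↔ Odd q := by
  obtain ⟨σ, hσq⟩ := exists_frobenius_ringHom hq hcard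
  have hq1 : 1 < q := hq.one_lt
  have hσ3 (x : F) : x ^ q ^ 3 = σ (σ (σ x)) := by simp only [hσq]; ring
  have hσ4 (x : F) : x ^ q ^ 4 = σ (σ (σ (σ x))) := by simp only [hσq]; ring
  have hσ5 (x : F) : x ^ q ^ 5 = σ (σ (σ (σ (σ x)))) := by simp only [hσq]; ring
  have hσ (x : F) : σ (σ (σ (σ (σ (σ x))))) = x := by
    have : x ^ q ^ 6 = σ (σ (σ (σ (σ (σ x))))) := by simp only [hσq]; ring
    rw [← this, ← hcard, FiniteField.pow_card]
  constructor
  · intro H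
    by_contra hodd
    have h2 : (2 : F) = 0 := by
      have h : ((q ^ 6 : ℕ) : F) = 0 := by rw [← hcard, FiniteField.cast_card_eq_zero]
      obtain ⟨p, k, hp, hk, rfl⟩ := hq
      have h2p : p = 2 := by
        by_contra hne
        exact hodd ((hp.nat_prime.odd_of_ne_two hne).pow)
      subst h2p
      push_cast at h
      exact eq_zero_of_pow_eq_zero (eq_zero_of_pow_eq_zero h)
    obtain ⟨m, a, b, e, hK⟩ := exists_linearized_mem_kernel hcard hq1 h2 σ hσq hσ hc
    have hcount := card_le_mul_ncard_of_linearized hq1 a b e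
      {x : F | m * x + 1 * x ^ q + 1 * x ^ (q ^ 3) + c * 1 * x ^ (q ^ 5) = 0} (by
        intro y
        have := hK y _ rfl
        simpa only [Set.mem_ofPred_eq, hσ3, hσ4, hσ5, ← hσq, one_mul, mul_one] using this)
    have hle := Nat.mul_le_mul_left (q ^ 4) (H m 1 (by simp))
    rw [hcard] at hcount
    have : q ^ 5 < q ^ 6 := Nat.pow_lt_pow_right hq1 (by norm_num)
    rw [show q ^ 4 * q = q ^ 5 from (pow_succ q 4).symm] at hle
    omega
  · intro hodd α β hαβ
    have h2 : (2 : F) ≠ 0 := by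
      apply Ring.two_ne_zero
      rw [Ne, FiniteField.even_card_iff_char_two, hcard]
      exact (Nat.odd_iff.mp hodd.pow).trans_ne one_ne_zero
    by_cases hS : ∃ x, x ≠ 0 ∧ α * x + β * x ^ q + β * x ^ (q ^ 3) + c * β * x ^ (q ^ 5) = 0
    · obtain ⟨x, hx0, hx⟩ := hS
      have hβ : β ≠ 0 := by
        rintro rfl
        have hα : α ≠ 0 := by rintro rfl; exact hαβ rfl
        simp [hα, hx0] at hx
      have key : ∀ z : F, α * z + β * z ^ q + β * z ^ (q ^ 3) + c * β * z ^ (q ^ 5) = 0 →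
          -α / β * z = σ z + σ (σ (σ z)) + c * σ (σ (σ (σ (σ z)))) := by
        intro z hz
        rw [hσ3, hσ5, ← hσq] at hz
        field_simp
        linear_combination -hz
      refine (Set.ncard_le_ncard (t := (fun z => z * x) '' {z : F | z ^ q = z}) ?_).trans
        ((Set.ncard_image_le (Set.toFinite _)).trans (ncard_pow_eq_self_le hq1))
      intro y hy
      have h := frobenius_ratio_fixed h2 σ hσ hc hx0 (key x hx) (key y hy)
      refine ⟨y / x, ?_, div_mul_cancel₀ y hx0⟩
      have hsx : σ x ≠ 0 := by simpa using hx0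
      rw [Set.mem_ofPred_eq, ← hσq, map_div₀, div_eq_div_iff hsx hx0, h]
    · push Not at hS
      refine (Set.ncard_le_ncard (t := {0}) ?_).trans ((Set.ncard_singleton _).trans_le hq1.le)
      intro x hx
      by_contra hx0
      exact hS x hx0 hx
end

section
/- Let q be a prime power, let c ∈ F_{q^6} satisfy c^2 + c = 1, and let U_c = {(x, x^q + x^{q^3} + c·x^{q^5}) : x ∈ F_{q^6}} ⊆ F_{q^6} × F_{q^6}. Then the following are equivalent: (i) for every (u, v) ∈ F_{q^6} × F_{q^6} with (u, v) ≠ (0, 0), the intersection of U_c with the F_{q^6}-line {λ·(u, v) : λ ∈ F_{q^6}} has at most q elements; (ii) q is odd. (That is, U_c is a maximum scattered F_q-subspace, equivalently the linear set L_c of PG(1, q^6) defined by U_c is scattered, if and only if q is odd.) -/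
/-- The `3 × 3` Plücker determinant built from the minors `x_i y_j - x_j y_i` vanishes. -/
theorem plucker_det {R : Type*} [CommRing R] (x0 x1 x2 x3 x4 x5 y0 y1 y2 y3 y4 y5 : R)
    {D0 D1 D2 D3 D4 D5 E0 E1 E2 : R}
    (hD0 : D0 = x1 * y0 - x0 * y1) (hD1 : D1 = x2 * y1 - x1 * y2)
    (hD2 : D2 = x3 * y2 - x2 * y3) (hD3 : D3 = x4 * y3 - x3 * y4)
    (hD4 : D4 = x5 * y4 - x4 * y5) (hD5 : D5 = x0 * y5 - x5 * y0)
    (hE0 : E0 = x3 * y0 - x0 * y3) (hE1 : E1 = x4 * y1 - x1 * y4)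
    (hE2 : E2 = x5 * y2 - x2 * y5) :
    D0 * D2 * D4 + E2 * D0 * D3 + E0 * D1 * D4
      = E0 * E1 * E2 + D1 * D3 * D5 + E1 * D2 * D5 := by
  subst_vars; ring

theorem cubic_of_fixed {K : Type*} [Field K] {c D0 D1 D2 E0 E1 E2 : K}
    (hc : c ^ 2 + c = 1)
    (hE0 : E0 = -D0 - c * D2) (hE1 : E1 = -D1 + c * D0) (hE2 : E2 = -D2 + c * D1)
    (hdet : D0 * D2 * (-D1) + E2 * D0 * (-D0) + E0 * D1 * (-D1)
      = E0 * E1 * E2 + D1 * (-D0) * (-D2) + E1 * D2 * (-D2)) :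
    E0 * E1 * E2 = 0 := by
  subst_vars
  grind

theorem cubic_of_conj {K : Type*} [Field K] (h2 : (2 : K) ≠ 0)
    {c D0 D1 D2 D3 D4 D5 E0 E1 E2 : K} (hc : c ^ 2 + c = 1)
    (h02 : D0 + D2 = -c * E1 - E2) (h24 : D2 + D4 = E1 + c * E0) (h04 : D0 + D4 = c * E2 - E0)
    (hD1 : D1 = (-1 - c) * D0 - E1) (hD3 : D3 = E0 + (-1 - c) * D2)
    (hD5 : D5 = E2 + (-1 - c) * D4)
    (hdet : D0 * D2 * D4 + E2 * D0 * D3 + E0 * D1 * D4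
      = E0 * E1 * E2 + D1 * D3 * D5 + E1 * D2 * D5) :
    E0 * E1 * E2 = 0 := by
  subst hD1 hD3 hD5
  grind

theorem map_eq_or_eq_neg_one_sub {K : Type*} [Field K] {c : K} (hc : c ^ 2 + c = 1)
    (φ : K →+* K) : φ c = c ∨ φ c = -1 - c := by
  have h : φ c ^ 2 + φ c = 1 := by simpa using congrArg φ hc
  have : (φ c - c) * (φ c - (-1 - c)) = 0 := by linear_combination h - hc
  rcases mul_eq_zero.1 this with h | h
  · exact .inl (sub_eq_zero.1 h)
  · exact .inr (sub_eq_zero.1 h)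

theorem map_map_eq_self {K : Type*} [Field K] {c : K} (hc : c ^ 2 + c = 1)
    (φ : K →+* K) : φ (φ c) = c := by
  rcases map_eq_or_eq_neg_one_sub hc φ with h | h
  · rw [h, h]
  · simp [h]

/-- In characteristic different from `2`, two vectors of `U_c` that are proportional over the field
are proportional over the fixed field of `φ`. -/
theorem mul_map_eq_of_proportional {K : Type*} [Field K] (h2 : (2 : K) ≠ 0) (φ : K →+* K)
    (h6 : ∀ x, φ (φ (φ (φ (φ (φ x))))) = x) {c : K} (hc : c ^ 2 + c = 1) {x y : K}
    (h : y * (φ x + φ (φ (φ x)) + c * φ (φ (φ (φ (φ x)))))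
      = x * (φ y + φ (φ (φ y)) + c * φ (φ (φ (φ (φ y)))))) :
    φ x * y = x * φ y := by
  have hcc := map_map_eq_self hc φ
  have h₁ := congrArg φ h
  have h₂ := congrArg φ h₁
  have h₃ := congrArg φ h₂
  have h₄ := congrArg φ h₃
  have h₅ := congrArg φ h₄
  simp only [map_mul, map_add, h6, hcc] at h₁ h₂ h₃ h₄ h₅
  have hdet := plucker_det x (φ x) (φ (φ x)) (φ (φ (φ x))) (φ (φ (φ (φ x))))
    (φ (φ (φ (φ (φ x))))) y (φ y) (φ (φ y)) (φ (φ (φ y))) (φ (φ (φ (φ y))))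
    (φ (φ (φ (φ (φ y))))) rfl rfl rfl rfl rfl rfl rfl rfl rfl
  obtain ⟨D0, hD0⟩ : ∃ D, D = φ x * y - x * φ y := ⟨_, rfl⟩
  obtain ⟨D1, hD1⟩ : ∃ D, D = φ (φ x) * φ y - φ x * φ (φ y) := ⟨_, rfl⟩
  obtain ⟨D2, hD2⟩ : ∃ D, D = φ (φ (φ x)) * φ (φ y) - φ (φ x) * φ (φ (φ y)) := ⟨_, rfl⟩
  obtain ⟨D3, hD3⟩ : ∃ D, D = φ (φ (φ (φ x))) * φ (φ (φ y)) - φ (φ (φ x)) * φ (φ (φ (φ y))) :=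
    ⟨_, rfl⟩
  obtain ⟨D4, hD4⟩ : ∃ D, D = φ (φ (φ (φ (φ x)))) * φ (φ (φ (φ y)))
    - φ (φ (φ (φ x))) * φ (φ (φ (φ (φ y)))) := ⟨_, rfl⟩
  obtain ⟨D5, hD5⟩ : ∃ D, D = x * φ (φ (φ (φ (φ y)))) - φ (φ (φ (φ (φ x)))) * y := ⟨_, rfl⟩
  obtain ⟨E0, hE0⟩ : ∃ E, E = φ (φ (φ x)) * y - x * φ (φ (φ y)) := ⟨_, rfl⟩
  obtain ⟨E1, hE1⟩ : ∃ E, E = φ (φ (φ (φ x))) * φ y - φ x * φ (φ (φ (φ y))) := ⟨_, rfl⟩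
  obtain ⟨E2, hE2⟩ : ∃ E, E = φ (φ (φ (φ (φ x)))) * φ (φ y) - φ (φ x) * φ (φ (φ (φ (φ y)))) :=
    ⟨_, rfl⟩
  rw [← hD0, ← hD1, ← hD2, ← hD3, ← hD4, ← hD5, ← hE0, ← hE1, ← hE2] at hdet
  have r₀ : D0 + E0 = c * D5 := by rw [hD0, hE0, hD5]; linear_combination h
  have r₁ : D1 + E1 = φ c * D0 := by rw [hD1, hE1, hD0]; linear_combination h₁
  have r₂ : D2 + E2 = c * D1 := by rw [hD2, hE2, hD1]; linear_combination h₂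
  have r₃ : D3 - E0 = φ c * D2 := by rw [hD3, hE0, hD2]; linear_combination h₃
  have r₄ : D4 - E1 = c * D3 := by rw [hD4, hE1, hD3]; linear_combination h₄
  have r₅ : D5 - E2 = φ c * D4 := by rw [hD5, hE2, hD4]; linear_combination h₅
  have s₀ : φ E0 = E1 := by simp [hE0, hE1]
  have s₁ : φ E1 = E2 := by simp [hE1, hE2]
  have s₂ : φ E2 = -E0 := by simp [hE2, hE0, h6]
  have hE : E0 * E1 * E2 = 0 → E0 = 0 ∧ E1 = 0 ∧ E2 = 0 := by
    have t₀ := map_eq_zero φ (a := E0)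
    have t₁ := map_eq_zero φ (a := E1)
    have t₂ := map_eq_zero φ (a := E2)
    rw [s₀] at t₀
    rw [s₁] at t₁
    rw [s₂, neg_eq_zero] at t₂
    simp only [mul_eq_zero]
    tauto
  have hc0 : c ≠ 0 := by rintro rfl; simp at hc
  suffices D0 = 0 from sub_eq_zero.1 (hD0 ▸ this)
  rcases map_eq_or_eq_neg_one_sub hc φ with hφ | hφ
  · rw [hφ] at r₁ r₃ r₅
    have hc1 : 2 - 2 * c ≠ 0 := by
      intro h
      have h' : 2 * (1 - c) = 0 := by linear_combination h
      have h1 : 1 - c = 0 := (mul_eq_zero.1 h').resolve_left h2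
      exact one_ne_zero (α := K) (by linear_combination hc + (c + 2) * h1)
    have e₀ : D0 + D3 = c * (D2 + D5) := by linear_combination r₀ + r₃
    have e₁ : D1 + D4 = c * (D0 + D3) := by linear_combination r₁ + r₄
    have e₂ : D2 + D5 = c * (D1 + D4) := by linear_combination r₂ + r₅
    have z₀ : D0 + D3 = 0 := by
      refine (mul_eq_zero.1 ?_).resolve_left hc1
      linear_combination e₀ + c * e₂ + c ^ 2 * e₁ + (c - 1) * (D0 + D3) * hc
    have z₁ : D1 + D4 = 0 := by rw [e₁, z₀, mul_zero]
    have z₂ : D2 + D5 = 0 := by rw [e₂, z₁, mul_zero]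
    rw [eq_neg_of_add_eq_zero_right z₀, eq_neg_of_add_eq_zero_right z₁,
      eq_neg_of_add_eq_zero_right z₂] at hdet
    obtain ⟨a₀, a₁, a₂⟩ := hE (cubic_of_fixed hc (by linear_combination r₀ + c * z₂)
      (by linear_combination r₁) (by linear_combination r₂) hdet)
    refine (mul_eq_zero.1 (?_ : (2 * c) * D0 = 0)).resolve_left (mul_ne_zero h2 hc0)
    grind
  · rw [hφ] at r₁ r₃ r₅
    obtain ⟨a₀, a₁, a₂⟩ := hE (cubic_of_conj h2 hc
      (by linear_combination c * r₁ + r₂ - D0 * hc)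
      (by linear_combination r₄ + c * r₃ - D2 * hc)
      (by linear_combination r₀ + c * r₅ - D4 * hc)
      (by linear_combination r₁) (by linear_combination r₃) (by linear_combination r₅) hdet)
    refine (mul_eq_zero.1 (?_ : 2 * D0 = 0)).resolve_left h2
    grind

theorem ncard_pow_add_eq_zero_le {K : Type*} [Field K] {n k l m : ℕ} (hk : k < n) (hl : l < n)
    (hm : m < n) (a b d : K) :
    {x : K | x ^ n + (a * x ^ k + b * x ^ l + d * x ^ m) = 0}.ncard ≤ n := by
  classical
  let r : Polynomial K := .C a * .X ^ k + .C b * .X ^ l + .C d * .X ^ m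
  have mem {e : K} {j : ℕ} (hj : j < n) :
      Polynomial.C e * Polynomial.X ^ j ∈ Polynomial.degreeLT K n :=
    Polynomial.mem_degreeLT.2
      ((Polynomial.degree_C_mul_X_pow_le j e).trans_lt (by exact_mod_cast hj))
  have hr : r.degree < n :=
    Polynomial.mem_degreeLT.1 (add_mem (add_mem (mem hk) (mem hl)) (mem hm))
  have hmonic := Polynomial.monic_X_pow_add hr
  have : {x : K | x ^ n + (a * x ^ k + b * x ^ l + d * x ^ m) = 0}
      = ((Polynomial.X ^ n + r).roots.toFinset : Set K) := by
    ext x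
    simp [Polynomial.mem_roots hmonic.ne_zero, r]
  rw [this, Set.ncard_coe_finset]
  calc _ ≤ Multiset.card (Polynomial.X ^ n + r).roots := Multiset.toFinset_card_le _
    _ ≤ _ := Polynomial.card_roots' _
    _ = n := by
      rw [add_comm, Polynomial.natDegree_add_eq_right_of_degree_lt (by simpa using hr),
        Polynomial.natDegree_X_pow]

/-- In characteristic `2`, the kernel of `1 + φ + φ²` has more than `q` elements. -/
theorem lt_ncard_ker {F : Type*} [Field F] [Fintype F] [CharP F 2] {q : ℕ} (hq : 1 < q)
    (hcard : Fintype.card F = q ^ 6) (φ : F →+* F) (hφ : ∀ x, φ x = x ^ q)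
    (h6 : ∀ x, φ (φ (φ (φ (φ (φ x))))) = x) :
    q < {w : F | φ (φ w) = φ w + w}.ncard := by
  let T : F →+ F := (φ.comp φ : F →+* F).toAddMonoidHom - (φ.toAddMonoidHom + AddMonoidHom.id F)
  have hT (w : F) : T w = φ (φ w) - (φ w + w) := rfl
  have hker : {w : F | φ (φ w) = φ w + w} = (T.ker : Set F) := by
    ext w
    simp [AddMonoidHom.mem_ker, hT, sub_eq_zero]
  have hrange : (T.range : Set F).ncard ≤ q ^ 4 := by
    refine (Set.ncard_le_ncard ?_ (Set.toFinite _)).trans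
      (ncard_pow_add_eq_zero_le (k := 1) (l := q) (m := q ^ 3) (n := q ^ 4) (K := F)
        (Nat.one_lt_pow (by norm_num) hq) (lt_self_pow₀ hq (by norm_num))
        (Nat.pow_lt_pow_right hq (by norm_num)) 1 1 1)
    rintro _ ⟨w, rfl⟩
    have h3 (v : F) : v ^ q ^ 3 = φ (φ (φ v)) := by simp only [hφ]; ring
    have h4 (v : F) : v ^ q ^ 4 = φ (φ (φ (φ v))) := by simp only [hφ]; ring
    have h2 : (2 : F) = 0 := CharTwo.two_eq_zero
    simp only [Set.mem_ofPred_eq, h3, h4, ← hφ, hT, map_sub, map_add, h6, pow_one]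
    linear_combination (-φ w - φ (φ (φ (φ w)))) * h2
  have hmul : (T.ker : Set F).ncard * (T.range : Set F).ncard = q ^ 6 := by
    have h := T.ker.card_mul_index
    rw [AddSubgroup.index_ker, Nat.card_eq_fintype_card (α := F), hcard] at h
    exact h
  rw [hker]
  by_contra! hle
  have : q ^ 6 ≤ q * q ^ 4 := hmul ▸ Nat.mul_le_mul hle hrange
  rw [← pow_succ'] at this
  exact absurd this (not_le.2 (Nat.pow_lt_pow_right hq (by norm_num)))

/-- In characteristic `2`, some nonzero `t` satisfies `φ t = c φ⁵ t`. -/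
theorem exists_map_eq_mul {F : Type*} [Field F] [Fintype F] [CharP F 2] {q : ℕ} (hq : 1 < q)
    (hcard : Fintype.card F = q ^ 6) (φ : F →+* F) (hφ : ∀ x, φ x = x ^ q)
    (h6 : ∀ x, φ (φ (φ (φ (φ (φ x))))) = x) {c : F} (hc : c ^ 2 + c = 1) :
    ∃ t : F, t ≠ 0 ∧ φ t = c * φ (φ (φ (φ (φ t)))) := by
  have h2 : (2 : F) = 0 := CharTwo.two_eq_zero
  have hcc := map_map_eq_self hc φ
  have hc3 : c ^ 3 = 1 := by linear_combination (c - 1) * hc + (c - 1) * h2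
  obtain ⟨s, hs⟩ : ∃ s : F, φ (φ (φ (φ s))) + φ c * φ (φ s) + φ c ^ 2 * s ≠ 0 := by
    by_contra! h
    have hle := ncard_pow_add_eq_zero_le (k := q ^ 2) (l := 1) (m := 0) (n := q ^ 4) (K := F)
      (Nat.pow_lt_pow_right hq (by norm_num)) (Nat.one_lt_pow (by norm_num) hq)
      (by positivity) (φ c) (φ c ^ 2) 0
    have huniv : {x : F | x ^ q ^ 4 + (φ c * x ^ q ^ 2 + φ c ^ 2 * x ^ 1 + 0 * x ^ 0) = 0}
        = Set.univ := by
      refine Set.eq_univ_of_forall fun x ↦ ?_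
      have h2' : x ^ q ^ 2 = φ (φ x) := by simp only [hφ]; ring
      have h4 : x ^ q ^ 4 = φ (φ (φ (φ x))) := by simp only [hφ]; ring
      rw [Set.mem_ofPred_eq, h2', h4]
      linear_combination h x
    rw [huniv, Set.ncard_univ, Nat.card_eq_fintype_card, hcard] at hle
    exact absurd hle (not_le.2 (Nat.pow_lt_pow_right hq (by norm_num)))
  refine ⟨_, hs, ?_⟩
  simp only [map_add, map_mul, map_pow, h6, hcc]
  linear_combination -φ (φ (φ (φ (φ s)))) * hc3

theorem stmt1 (q : ℕ) (hq : IsPrimePow q)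
    (F : Type*) [Field F] [Fintype F] (hcard : Fintype.card F = q ^ 6)
    (c : F) (hc : c ^ 2 + c = 1) :
    (∀ u v : F, (u, v) ≠ (0, 0) →
        ({p : F × F | (∃ x : F, p = (x, x ^ q + x ^ (q ^ 3) + c * x ^ (q ^ 5))) ∧
            ∃ l : F, p = (l * u, l * v)} : Set (F × F)).ncard ≤ q)
      ↔ Odd q := by
  obtain ⟨p, k, hp, hk, rfl⟩ := (isPrimePow_nat_iff q).1 hq
  have : Fact p.Prime := ⟨hp⟩
  have hchar : CharP F p := by
    refine (CharP.charP_iff_prime_eq_zero hp).2 ?_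
    have h0 : ((p : F) ^ k) ^ 6 = 0 := by
      rw [← FiniteField.cast_card_eq_zero F, hcard]
      push_cast
      rfl
    exact pow_eq_zero_iff (by omega) |>.1 (pow_eq_zero_iff (by norm_num) |>.1 h0)
  let φ : F →+* F := iterateFrobenius F p k
  have hφ (x : F) : φ x = x ^ p ^ k := iterateFrobenius_def p k x
  have hq1 : 1 < p ^ k := hq.one_lt
  have hpar : p = 2 ∨ Odd (p ^ k) := hp.eq_two_or_odd'.imp_right Odd.pow
  have htwo (hodd : Odd (p ^ k)) : (2 : F) ≠ 0 := by
    intro h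
    have hdvd : p ∣ 2 := (CharP.cast_eq_zero_iff F p 2).1 (by exact_mod_cast h)
    rw [(Nat.prime_dvd_prime_iff_eq hp Nat.prime_two).1 hdvd] at hodd
    exact Nat.not_odd_iff_even.2 (even_two.pow_of_ne_zero hk.ne') hodd
  generalize p ^ k = q at *
  have h3 (x : F) : x ^ q ^ 3 = φ (φ (φ x)) := by simp only [hφ]; ring
  have h5 (x : F) : x ^ q ^ 5 = φ (φ (φ (φ (φ x)))) := by simp only [hφ]; ring
  have h6 (x : F) : φ (φ (φ (φ (φ (φ x))))) = x := by
    rw [← h5, hφ, ← pow_mul, ← pow_succ', ← hcard, FiniteField.pow_card]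
  simp only [h3, h5, ← hφ]
  constructor
  · intro h
    refine hpar.resolve_left ?_
    rintro rfl
    obtain ⟨t, ht, htc⟩ := exists_map_eq_mul hq1 hcard φ hφ h6 hc
    refine absurd (h t (φ t + φ (φ (φ t))) (by simp [ht]))
      (not_le.2 ((lt_ncard_ker hq1 hcard φ hφ h6).trans_le ?_))
    refine Set.ncard_le_ncard_of_injOn (fun w ↦ (w * t, w * (φ t + φ (φ (φ t))))) ?_ ?_
      (Set.toFinite _)
    · intro w hw
      rw [Set.mem_ofPred_eq] at hw
      refine ⟨⟨w * t, Prod.ext rfl ?_⟩, w, rfl⟩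
      have hw3 : φ (φ (φ w)) = w := by
        rw [hw, map_add, hw]
        linear_combination φ w * CharTwo.two_eq_zero (R := F)
      have hw5 : φ (φ (φ (φ (φ w)))) = φ w + w := by rw [hw3, hw]
      simp only [map_mul]
      rw [hw5, hw3]
      linear_combination (φ w + w) * htc - φ t * φ w * CharTwo.two_eq_zero (R := F)
    · intro w _ w' _ hww
      exact mul_right_cancel₀ ht (Prod.ext_iff.1 hww).1
  · intro hodd u v huv
    set S : Set (F × F) := {p : F × F | (∃ x : F, p = (x, φ x + φ (φ (φ x)) +
      c * φ (φ (φ (φ (φ x)))))) ∧ ∃ l : F, p = (l * u, l * v)}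
    by_cases hS0 : S ⊆ {0}
    · exact (Set.ncard_le_ncard hS0).trans (by simpa using hq1.le)
    obtain ⟨_, ⟨⟨y, rfl⟩, m, hm⟩, hy⟩ := Set.not_subset.1 hS0
    have hy0 : y ≠ 0 := by
      rintro rfl
      simp at hy
    obtain ⟨hmu, hmv⟩ := Prod.ext_iff.1 hm
    dsimp only at hmu hmv
    have hfix := ncard_pow_add_eq_zero_le (K := F) hq1 hq1 hq1 (-1) 0 0
    refine (Set.ncard_le_ncard ?_ (Set.toFinite _)).trans ((Set.ncard_image_le
      (f := fun r ↦ (r * y, φ (r * y) + φ (φ (φ (r * y))) + c * φ (φ (φ (φ (φ (r * y)))))))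
      (Set.toFinite _)).trans hfix)
    rintro _ ⟨⟨x, rfl⟩, l, hl⟩
    obtain ⟨hlu, hlv⟩ := Prod.ext_iff.1 hl
    dsimp only at hlu hlv
    have hxy := mul_map_eq_of_proportional (htwo hodd) φ h6 hc (x := x) (y := y) (by
      rw [hlv, hmv]
      rw [hlu, hmu]
      ring)
    refine ⟨x / y, ?_, by simp only [div_mul_cancel₀ x hy0]⟩
    have hφy : φ y ≠ 0 := (map_ne_zero φ).2 hy0
    rw [Set.mem_ofPred_eq, ← hφ, map_div₀]
    field_simp
    linear_combination hxy
end

section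
/- Let q be a prime power and c ∈ F_{q^6} with c^2 + c = 1. Then the following are equivalent: (i) for every (α, β) ∈ F_{q^6} × F_{q^6} with (α, β) ≠ (0, 0), the set {x ∈ F_{q^6} : α·x + β·x^q + β·x^{q^3} + c·β·x^{q^5} = 0} has at most q elements (i.e. the code C is an MRD-code with minimum distance 5); (ii) there exist NO α, β, γ ∈ F_{q^6} satisfying simultaneously: α ≠ 0; (c − γ)^{(q^6−1)/(q−1)} = 1; (c − γ)·( −(c − γ)^{q^4+q^2} + β^{q^5+q^4}·(c − γ)^{q^4+q^3+q^2} + β^{q^2+q} ) = 1; α = −(c − γ)^{q+1}·β^{q^2}; γ = −(c − γ)^{q^2+1} + β^{q^3+q^2}·(c − γ)^{q^2+q+1}; and β = (c − γ)^{q^3+q^2+1}·β^{q^4} + β^{q^2}·(c − γ)^{q^3+q+1} − β^{q^4+q^3+q^2}·(c − γ)^{q^3+q^2+q+1}. -/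
theorem exists_ringHom_eq_pow {q n : ℕ} (hq : IsPrimePow q) {F : Type*} [Field F] [Fintype F]
    (hcard : Fintype.card F = q ^ n) : ∃ φ : F →+* F, ∀ x, φ x = x ^ q := by
  obtain ⟨p, k, hp, hk, rfl⟩ := hq
  have hp' : p.Prime := hp.nat_prime
  obtain ⟨m, hr, hm⟩ := FiniteField.card F (ringChar F)
  have hpr : p = ringChar F := by
    have h1 : ringChar F ∣ (p ^ k) ^ n := by
      rw [← hcard, hm]; exact dvd_pow_self _ m.ne_zero
    exact ((Nat.prime_dvd_prime_iff_eq hr hp').1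
      (hr.dvd_of_dvd_pow (hr.dvd_of_dvd_pow h1))).symm
  have : Fact p.Prime := ⟨hp'⟩
  have : CharP F p := hpr ▸ ringChar.charP F
  exact ⟨iterateFrobenius F p k, fun x => iterateFrobenius_def p k x⟩

theorem false_of_trinomial_eqs {F : Type*} [Field F] {φ : F →+* F}
    (hφ : ∀ x, φ (φ (φ (φ (φ (φ x))))) = x) {c d : F} (hc : c ^ 2 + c = 1)
    (h1 : d * φ (φ d) * φ (φ (φ (φ d))) = -1) (h2 : c - d = -(φ (φ d) * d)) : False := by
  have hc1 : φ c ^ 2 + φ c = 1 := by simpa using congrArg φ hc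
  have hc2 : φ (φ c) = c := by
    have h : (φ c - c) * (φ c + c + 1) = 0 := by linear_combination hc1 - hc
    rcases mul_eq_zero.1 h with h | h
    · rw [sub_eq_zero.1 h, sub_eq_zero.1 h]
    · have h' : φ c = -c - 1 := by linear_combination h
      rw [h', map_sub, map_neg, h', map_one]; ring
  have h3 : c - φ (φ d) = -(φ (φ (φ (φ d))) * φ (φ d)) := by
    simpa [hc2] using congrArg φ (congrArg φ h2)
  have h4 : c - φ (φ (φ (φ d))) = -(d * φ (φ (φ (φ d)))) := by
    simpa [hc2, hφ] using congrArg φ (congrArg φ h3)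
  have h5 : (1 - c) * (φ (φ (φ (φ d))) + 1) = 0 := by
    linear_combination h1 - h2 * φ (φ (φ (φ d))) - h4
  rcases mul_eq_zero.1 h5 with h | h
  · have : (1 : F) = 0 := by linear_combination hc + (c + 2) * h
    exact one_ne_zero this
  · have h6 : φ (φ (φ (φ d))) = -1 := by linear_combination h
    have h7 : d = -1 := by
      have := congrArg φ (congrArg φ h6)
      simpa [hφ] using this
    rw [h7] at h2
    simp at h2
    have h8 : c = -2 := by linear_combination h2
    rw [h8] at hc
    exact one_ne_zero (α := F) (by linear_combination hc)

theorem exists_of_wronskian {F : Type*} [Field F] {φ : F →+* F}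
    (hφ : ∀ x, φ (φ (φ (φ (φ (φ x))))) = x) {c u v : F}
    (hw : φ u * v - u * φ v ≠ 0)
    (huv : u * (φ v + φ (φ (φ v)) + c * φ (φ (φ (φ (φ v)))))
      = v * (φ u + φ (φ (φ u)) + c * φ (φ (φ (φ (φ u)))))) :
    ∃ α β γ d : F, d = c - γ ∧
      d * φ d * φ (φ d) * φ (φ (φ d)) * φ (φ (φ (φ d))) * φ (φ (φ (φ (φ d)))) = 1 ∧
      d * (-(φ (φ (φ (φ d))) * φ (φ d))
        + φ (φ (φ (φ (φ β)))) * φ (φ (φ (φ β))) *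
          (φ (φ (φ (φ d))) * φ (φ (φ d)) * φ (φ d)) + φ (φ β) * φ β) = 1 ∧
      α = -(φ d * d) * φ (φ β) ∧
      γ = -(φ (φ d) * d) + φ (φ (φ β)) * φ (φ β) * (φ (φ d) * φ d * d) ∧
      β = φ (φ (φ d)) * φ (φ d) * d * φ (φ (φ (φ β))) + φ (φ β) * (φ (φ (φ d)) * φ d * d)
        - φ (φ (φ (φ β))) * φ (φ (φ β)) * φ (φ β) * (φ (φ (φ d)) * φ (φ d) * φ d * d) := by
  obtain ⟨w, hw_eq⟩ : ∃ w, w = φ u * v - u * φ v := ⟨_, rfl⟩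
  obtain ⟨t, ht⟩ : ∃ t, t = φ (φ (φ (φ u))) * v - u * φ (φ (φ (φ v))) := ⟨_, rfl⟩
  have hw0 : w ≠ 0 := hw_eq ▸ hw
  have hw1 : φ w ≠ 0 := (map_ne_zero φ).2 hw0
  have hw2 : φ (φ w) ≠ 0 := (map_ne_zero φ).2 hw1
  have hw3 : φ (φ (φ w)) ≠ 0 := (map_ne_zero φ).2 hw2
  have hw4 : φ (φ (φ (φ w))) ≠ 0 := (map_ne_zero φ).2 hw3
  have hw5 : φ (φ (φ (φ (φ w)))) ≠ 0 := (map_ne_zero φ).2 hw4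
  refine ⟨_, t / φ (φ (φ (φ (φ w)))), c - w / φ (φ (φ (φ (φ w)))), w / φ (φ (φ (φ (φ w)))),
    (sub_sub_cancel _ _).symm, ?_, ?_, rfl, ?_, ?_⟩
  · simp only [map_div₀, hφ]
    field_simp
  · simp only [map_div₀, hφ]
    field_simp
    simp only [hw_eq, ht, map_sub, map_mul, hφ]
    ring
  · have : c - w / φ (φ (φ (φ (φ w)))) =
        (φ (φ (φ u)) * v - u * φ (φ (φ v))) / φ (φ (φ (φ (φ w)))) := by
      field_simp
      simp only [hw_eq, map_sub, map_mul, hφ]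
      linear_combination huv
    rw [this]
    simp only [map_div₀, hφ]
    field_simp
    simp only [hw_eq, ht, map_sub, map_mul, hφ]
    ring
  · simp only [map_div₀, hφ]
    field_simp
    simp only [hw_eq, ht, map_sub, map_mul, hφ]
    ring

open Polynomial in
theorem sq_le_card_ker_of_eval_eq_zero {F : Type*} [Field F] [Fintype F] {q : ℕ} (hq : 0 < q)
    (hcard : Fintype.card F = q ^ 6) (H : F →+ F) {p : F[X]} (hp : p ≠ 0)
    (hdeg : p.natDegree ≤ q ^ 4) (hH : ∀ x, p.eval (H x) = 0) : q ^ 2 ≤ Nat.card H.ker := by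
  classical
  have hprod : Nat.card H.ker * Nat.card H.range = q ^ 6 := by
    rw [← AddSubgroup.index_ker, AddSubgroup.card_mul_index, Nat.card_eq_fintype_card, hcard]
  have hrange : Nat.card H.range ≤ q ^ 4 := by
    have hsub : (H.range : Set F) ⊆ (p.roots.toFinset : Set F) := by
      rintro _ ⟨x, rfl⟩
      simpa [hp] using hH x
    calc Nat.card H.range = (H.range : Set F).ncard := rfl
      _ ≤ (p.roots.toFinset : Set F).ncard := Set.ncard_le_ncard hsub
      _ = p.roots.toFinset.card := Set.ncard_coe_finset _
      _ ≤ p.roots.card := Multiset.toFinset_card_le _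
      _ ≤ q ^ 4 := (card_roots' p).trans hdeg
  have h : q ^ 2 * q ^ 4 ≤ Nat.card H.ker * q ^ 4 := by
    rw [← pow_add, ← hprod]
    exact Nat.mul_le_mul_left _ hrange
  exact Nat.le_of_mul_le_mul_right h (by positivity)

open Polynomial in
theorem sq_le_ncard_roots {F : Type*} [Field F] [Fintype F] {q : ℕ} (hq : 1 < q)
    (hcard : Fintype.card F = q ^ 6) {φ : F →+* F} (hpow : ∀ x, φ x = x ^ q)
    (hφ : ∀ x, φ (φ (φ (φ (φ (φ x))))) = x) {d β : F}
    (h₁ : d * (-(φ (φ (φ (φ d))) * φ (φ d))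
        + φ (φ (φ (φ (φ β)))) * φ (φ (φ (φ β))) *
          (φ (φ (φ (φ d))) * φ (φ (φ d)) * φ (φ d)) + φ (φ β) * φ β) = 1)
    (h₂ : β = φ (φ (φ d)) * φ (φ d) * d * φ (φ (φ (φ β)))
        + φ (φ β) * (φ (φ (φ d)) * φ d * d)
        - φ (φ (φ (φ β))) * φ (φ (φ β)) * φ (φ β) * (φ (φ (φ d)) * φ (φ d) * φ d * d)) :
    q ^ 2 ≤ {x : F | φ x + d * φ β * x + d * φ (φ (φ (φ (φ x)))) = 0}.ncard := by
  have hd : d ≠ 0 := by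
    rintro rfl
    simp at h₁
  have h₃ := congrArg φ h₂
  simp only [map_sub, map_add, map_mul] at h₃
  let H : F →+ F :=
    { toFun := fun x => φ x + d * φ β * x + d * φ (φ (φ (φ (φ x))))
      map_zero' := by simp
      map_add' := fun x y => by simp only [map_add]; ring }
  obtain ⟨s, hs⟩ : ∃ s, s = d * φ β := ⟨_, rfl⟩
  obtain ⟨a₃, ha₃⟩ : ∃ a, a = -φ (φ (φ (φ s))) := ⟨_, rfl⟩
  obtain ⟨a₂, ha₂⟩ : ∃ a, a = φ (φ (φ (φ s))) * φ (φ (φ s)) - φ (φ (φ (φ d))) := ⟨_, rfl⟩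
  obtain ⟨a₁, ha₁⟩ : ∃ a, a = -φ (φ (φ (φ s))) * φ (φ (φ s)) * φ (φ s)
    + φ (φ (φ (φ s))) * φ (φ (φ d)) + φ (φ (φ (φ d))) * φ (φ s) := ⟨_, rfl⟩
  let r : F[X] := C a₃ * X ^ q ^ 3 + C a₂ * X ^ q ^ 2 + C a₁ * X ^ q - C d⁻¹ * X
  have hr : r.degree < ((q ^ 4 : ℕ) : WithBot ℕ) := by
    have key : ∀ (a : F) (k : ℕ), k < q ^ 4 → (C a * X ^ k).degree < ((q ^ 4 : ℕ) : WithBot ℕ) :=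
      fun a k hk => (degree_C_mul_X_pow_le k a).trans_lt (by exact_mod_cast hk)
    have lt : ∀ k, k < 4 → q ^ k < q ^ 4 := fun k hk => Nat.pow_lt_pow_right hq hk
    refine (degree_sub_le _ _).trans_lt (max_lt ((degree_add_le _ _).trans_lt (max_lt
      ((degree_add_le _ _).trans_lt (max_lt (key _ _ (lt 3 (by simp)))
        (key _ _ (lt 2 (by simp))))) ?_)) ?_)
    · exact key _ _ (by simpa using lt 1 (by simp))
    · simpa using key d⁻¹ 1 (by simpa using lt 0 (by simp))
  have hmonic : (X ^ q ^ 4 + r).Monic := monic_X_pow_add hr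
  have hdeg : (X ^ q ^ 4 + r).natDegree ≤ q ^ 4 :=
    natDegree_le_iff_degree_le.2 ((degree_add_le _ _).trans
      (max_le (degree_X_pow_le _) hr.le))
  refine sq_le_card_ker_of_eval_eq_zero (by lia) hcard H hmonic.ne_zero hdeg fun x => ?_
  have e₂ : ∀ x, x ^ q ^ 2 = φ (φ x) := fun x => by rw [hpow, hpow, ← pow_mul, sq]
  have e₃ : ∀ x, x ^ q ^ 3 = φ (φ (φ x)) := fun x => by rw [hpow, ← e₂, ← pow_mul, pow_succ]
  have e₄ : ∀ x, x ^ q ^ 4 = φ (φ (φ (φ x))) := fun x => by rw [hpow, ← e₃, ← pow_mul, pow_succ]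
  have hHx : H x = φ x + s * x + d * φ (φ (φ (φ (φ x)))) := by rw [hs]; rfl
  simp only [r, eval_add, eval_sub, eval_mul, eval_C, eval_pow, eval_X, e₂, e₃, e₄, ← hpow, hHx,
    map_add, map_mul, hφ]
  refine (mul_eq_zero.1 (?_ : d * _ = 0)).resolve_left hd
  simp only [ha₁, ha₂, ha₃, hs, map_mul]
  field_simp
  linear_combination φ x * h₁ - (d * x + d * φ (φ β) * φ x) * h₃

theorem exists_mem_wronskian_ne_zero {F : Type*} [Field F] [Fintype F] {q : ℕ} (hq : 1 < q)
    {φ : F →+* F} (hpow : ∀ x, φ x = x ^ q) {R : Set F} (hR : q < R.ncard) :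
    ∃ u ∈ R, ∃ v ∈ R, φ u * v - u * φ v ≠ 0 := by
  classical
  obtain ⟨u, hu, hu0⟩ := Set.exists_ne_of_one_lt_ncard (hq.trans hR) 0
  refine ⟨u, hu, ?_⟩
  by_contra! h
  have hsub : R ⊆ (fun y => y * u) ''
      ((Polynomial.X ^ q - Polynomial.X : Polynomial F).roots.toFinset : Set F) := by
    intro v hv
    refine ⟨v / u, ?_, div_mul_cancel₀ v hu0⟩
    have h0 : (Polynomial.X ^ q - Polynomial.X : Polynomial F) ≠ 0 :=
      FiniteField.X_pow_card_sub_X_ne_zero F hq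
    have hφu : φ u ≠ 0 := (map_ne_zero φ).2 hu0
    simp only [Finset.mem_coe, Multiset.mem_toFinset, Polynomial.mem_roots h0,
      Polynomial.IsRoot.def, Polynomial.eval_sub, Polynomial.eval_pow, Polynomial.eval_X,
      ← hpow, map_div₀]
    field_simp
    linear_combination -h v hv
  have hle := calc R.ncard
      _ ≤ _ := Set.ncard_le_ncard hsub
      _ ≤ _ := Set.ncard_image_le
      _ = _ := Set.ncard_coe_finset _
      _ ≤ _ := Multiset.toFinset_card_le _
      _ ≤ _ := Polynomial.card_roots' _
      _ = q := FiniteField.X_pow_card_sub_X_natDegree_eq F hq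
  lia

theorem stmt2 (q : ℕ) (hq : IsPrimePow q)
    (F : Type*) [Field F] [Fintype F] (hcard : Fintype.card F = q ^ 6)
    (c : F) (hc : c ^ 2 + c = 1) :
    (∀ α β : F, (α, β) ≠ (0, 0) →
        ({x : F | α * x + β * x ^ q + β * x ^ (q ^ 3) + c * β * x ^ (q ^ 5) = 0} : Set F).ncard ≤ q)
      ↔ ¬ ∃ α β γ : F,
          α ≠ 0 ∧
          (c - γ) ^ ((q ^ 6 - 1) / (q - 1)) = 1 ∧
          (c - γ) * (-(c - γ) ^ (q ^ 4 + q ^ 2)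
              + β ^ (q ^ 5 + q ^ 4) * (c - γ) ^ (q ^ 4 + q ^ 3 + q ^ 2)
              + β ^ (q ^ 2 + q)) = 1 ∧
          α = -(c - γ) ^ (q + 1) * β ^ (q ^ 2) ∧
          γ = -(c - γ) ^ (q ^ 2 + 1) + β ^ (q ^ 3 + q ^ 2) * (c - γ) ^ (q ^ 2 + q + 1) ∧
          β = (c - γ) ^ (q ^ 3 + q ^ 2 + 1) * β ^ (q ^ 4)
              + β ^ (q ^ 2) * (c - γ) ^ (q ^ 3 + q + 1)
              - β ^ (q ^ 4 + q ^ 3 + q ^ 2) * (c - γ) ^ (q ^ 3 + q ^ 2 + q + 1) := by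
  obtain ⟨φ, hpow⟩ := exists_ringHom_eq_pow hq hcard
  have hq1 : 1 < q := hq.one_lt
  have e₁ : ∀ x, x ^ q = φ x := fun x => (hpow x).symm
  have e₂ : ∀ x, x ^ q ^ 2 = φ (φ x) := fun x => by rw [hpow, hpow, ← pow_mul, sq]
  have e₃ : ∀ x, x ^ q ^ 3 = φ (φ (φ x)) := fun x => by rw [hpow, ← e₂, ← pow_mul, pow_succ]
  have e₄ : ∀ x, x ^ q ^ 4 = φ (φ (φ (φ x))) := fun x => by rw [hpow, ← e₃, ← pow_mul, pow_succ]
  have e₅ : ∀ x, x ^ q ^ 5 = φ (φ (φ (φ (φ x)))) := fun x => by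
    rw [hpow, ← e₄, ← pow_mul, pow_succ]
  have hφ : ∀ x, φ (φ (φ (φ (φ (φ x))))) = x := fun x => by
    rw [hpow, ← e₅, ← pow_mul, ← pow_succ, ← hcard, FiniteField.pow_card]
  have hN : (q ^ 6 - 1) / (q - 1) = q ^ 5 + q ^ 4 + q ^ 3 + q ^ 2 + q + 1 := by
    rw [← Nat.geomSum_eq hq1 6]
    simp only [Finset.sum_range_succ, Finset.sum_range_zero]
    ring
  simp only [hN, pow_add, pow_one, e₁, e₂, e₃, e₄, e₅]
  constructor
  · rintro hmrd ⟨α, β, γ, -, -, h₁, -, hγ, h₂⟩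
    have hker := sq_le_ncard_roots hq1 hcard hpow hφ h₁ h₂
    obtain ⟨d, hd⟩ : ∃ d, d = c - γ := ⟨_, rfl⟩
    rw [← hd] at hγ hker
    have hle := hmrd (d * φ β * (1 + φ (φ d) * φ (φ (φ β)) * (φ d * φ (φ β)) - φ (φ d))
      - φ (φ d) * φ (φ (φ β)) * φ d) 1 (by simp)
    refine absurd (hker.trans ((Set.ncard_le_ncard fun x hx => ?_).trans hle)) (by nlinarith)
    have hx₀ : φ x + d * φ β * x + d * φ (φ (φ (φ (φ x)))) = 0 := hx
    have hx₁ := congrArg φ hx₀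
    have hx₂ := congrArg φ hx₁
    simp only [map_add, map_mul, map_zero, hφ] at hx₁ hx₂
    simp only [Set.mem_ofPred_eq]
    linear_combination (1 + φ (φ d) * φ (φ (φ β)) * (φ d * φ (φ β)) - φ (φ d)) * hx₀ + hx₂
      - φ (φ d) * φ (φ (φ β)) * hx₁ + φ (φ (φ (φ (φ x)))) * (hγ - hd)
  · contrapose!
    rintro ⟨A, B, hAB, hlt⟩
    obtain ⟨u, hu, v, hv, hw⟩ := exists_mem_wronskian_ne_zero hq1 hpow hlt
    simp only [Set.mem_ofPred_eq] at hu hv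
    have hB : B ≠ 0 := by
      rintro rfl
      have hA : A ≠ 0 := by simpa using hAB
      simp only [zero_mul, mul_zero, add_zero, mul_eq_zero, hA, false_or] at hu
      simp only [zero_mul, mul_zero, add_zero, mul_eq_zero, hA, false_or] at hv
      simp [hu, hv] at hw
    obtain ⟨α, β, γ, d, rfl, hnorm, h₁, hα, hγ, h₂⟩ := exists_of_wronskian (c := c) hφ hw
      (mul_left_cancel₀ hB (by linear_combination u * hv - v * hu))
    refine ⟨α, β, γ, ?_, by linear_combination hnorm, h₁, hα, hγ, h₂⟩
    rintro rfl
    have hd : c - γ ≠ 0 := by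
      intro h
      simp [h] at h₁
    have hβ : β = 0 := by
      simpa only [zero_eq_mul, neg_eq_zero, mul_eq_zero, map_eq_zero, hd, false_or,
        or_false] using hα
    subst hβ
    refine false_of_trinomial_eqs hφ (d := c - γ) hc ?_ ?_
    · simp only [map_zero] at h₁
      linear_combination -h₁
    · simp only [map_zero] at hγ
      linear_combination hγ
end

section
/- Let q be an odd prime power with q ≡ 2 or 3 (mod 5), let c ∈ F_{q^6} satisfy c^2 + c = 1, and let λ ∈ F_{q^6} satisfy λ^{q^3} = λ and λ^{q^2+q+1} = 1. Then T̄ := ( c + λ^{q^2+q}·(c + 2) − c·λ^{q^2} )/2 is the unique element T ∈ F_{q^6} satisfying T^q + c·λ·T − λ = 0. -/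
/-- If `p ^ n ≡ ±2 (mod 5)`, then `p ≡ ±2 (mod 5)` and `n` is odd. -/
theorem mod_five_and_odd_of_pow_mod_five {p n : ℕ} (h : p ^ n % 5 = 2 ∨ p ^ n % 5 = 3) :
    (p % 5 = 2 ∨ p % 5 = 3) ∧ Odd n := by
  have hsq (a : ℕ) : a ^ 2 % 5 = 0 ∨ a ^ 2 % 5 = 1 ∨ a ^ 2 % 5 = 4 := by
    have : a % 5 < 5 := Nat.mod_lt _ (by norm_num)
    rw [Nat.pow_mod]
    interval_cases a % 5 <;> simp
  obtain ⟨k, rfl⟩ | ⟨k, rfl⟩ := n.even_or_odd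
  · have := hsq (p ^ k)
    rw [← pow_mul, mul_two, pow_add] at this
    rw [pow_add] at h
    omega
  · refine ⟨?_, k, rfl⟩
    have := hsq (p ^ k)
    rw [← pow_mul, mul_comm k 2] at this
    rw [pow_succ, Nat.mul_mod] at h
    have hp : p % 5 < 5 := Nat.mod_lt _ (by norm_num)
    rcases this with h1 | h1 | h1 <;> rw [h1] at h <;> omega

/-- A square root of `5` is negated by the Frobenius in characteristic `p ≡ ±2 (mod 5)`. -/
theorem pow_char_eq_neg_of_sq_eq_five {F : Type*} [Field F] {p : ℕ} [Fact p.Prime] [CharP F p]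
    (hp2 : p ≠ 2) (hp5 : p % 5 = 2 ∨ p % 5 = 3) {s : F} (hs : s ^ 2 = 5) : s ^ p = -s := by
  have h2 : ¬IsSquare (2 : ZMod 5) := by decide
  have h3 : ¬IsSquare (3 : ZMod 5) := by decide
  have : Fact (Nat.Prime 5) := ⟨by norm_num⟩
  have h5 : legendreSym 5 p = -1 := by
    rw [legendreSym.mod, legendreSym.eq_neg_one_iff]
    rcases hp5 with h | h
    · rw [show (p : ℤ) % (5 : ℕ) = 2 by omega]; exact h2
    · rw [show (p : ℤ) % (5 : ℕ) = 3 by omega]; exact h3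
  have hL : legendreSym p 5 = -1 := by
    rw [← h5]
    exact_mod_cast
      (legendreSym.quadratic_reciprocity_one_mod_four (p := 5) (q := p) (by norm_num) hp2)
  have hpow := legendreSym.eq_pow p 5
  rw [hL] at hpow
  have hF := congrArg (ZMod.castHom (dvd_refl p) F) hpow
  simp only [Int.cast_neg, Int.cast_one, Int.cast_ofNat, map_neg, map_one, map_pow,
    map_ofNat] at hF
  have hodd : 2 * (p / 2) + 1 = p :=
    Nat.two_mul_div_two_add_one_of_odd ((Fact.out : p.Prime).odd_of_ne_two hp2)
  calc s ^ p = (s ^ 2) ^ (p / 2) * s := by rw [← pow_mul, ← pow_succ, hodd]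
    _ = -s := by rw [hs, ← hF]; ring

theorem pow_eq_neg_one_sub_of_sq_add_self {F : Type*} [Field F] {p n : ℕ} [Fact p.Prime]
    [CharP F p] (hp2 : p ≠ 2) (hq : p ^ n % 5 = 2 ∨ p ^ n % 5 = 3) {c : F}
    (hc : c ^ 2 + c = 1) : c ^ p ^ n = -1 - c := by
  obtain ⟨hp5, hn⟩ := mod_five_and_odd_of_pow_mod_five hq
  have h2 : (2 : F) ≠ 0 := Ring.two_ne_zero (by rwa [ringChar.eq F p])
  have hs := pow_char_eq_neg_of_sq_eq_five (s := 2 * c + 1) hp2 hp5 (by linear_combination 4 * hc)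
  have hiter (m : ℕ) : (2 * c + 1) ^ p ^ m = (-1) ^ m * (2 * c + 1) := by
    induction m with
    | zero => simp
    | succ m ih =>
      rw [pow_succ p, pow_mul, ih, mul_pow, hs, ← pow_mul, mul_comm m p, pow_mul,
        ((Fact.out : p.Prime).odd_of_ne_two hp2).neg_one_pow]
      ring
  have h := hiter n
  rw [hn.neg_one_pow, ← iterateFrobenius_def, map_add, map_mul, map_ofNat, map_one,
    iterateFrobenius_def] at h
  apply mul_left_cancel₀ h2
  linear_combination h

theorem stmt4 (q : ℕ) (hq : IsPrimePow q) (hodd : Odd q)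
    (hq5 : q % 5 = 2 ∨ q % 5 = 3)
    (F : Type*) [Field F] [Fintype F] (hcard : Fintype.card F = q ^ 6)
    (c : F) (hc : c ^ 2 + c = 1)
    (l : F) (hl3 : l ^ (q ^ 3) = l) (hl : l ^ (q ^ 2 + q + 1) = 1) :
    ∀ T : F, T ^ q + c * l * T - l = 0 ↔
      T = (c + l ^ (q ^ 2 + q) * (c + 2) - c * l ^ (q ^ 2)) / 2 := by
  obtain ⟨p, n, hp, hn, rfl⟩ := (isPrimePow_nat_iff _).1 hq
  have : Fact p.Prime := ⟨hp⟩
  have : CharP F p := charP_of_card_eq_prime_pow (f := n * 6)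
    (by rw [hcard, pow_mul])
  have hp2 : p ≠ 2 := by
    rintro rfl
    exact absurd ((Nat.odd_pow_iff hn.ne').1 hodd) (by decide)
  have h2 : (2 : F) ≠ 0 := Ring.two_ne_zero (by rwa [ringChar.eq F p])
  have hcφ := pow_eq_neg_one_sub_of_sq_add_self hp2 hq5 hc
  have hφ (x : F) : x ^ p ^ n = iterateFrobenius F p n x := (iterateFrobenius_def ..).symm
  set φ := iterateFrobenius F p n
  have h6 (x : F) : φ (φ (φ (φ (φ (φ x))))) = x := by
    simp only [← hφ, ← pow_mul]
    conv_rhs => rw [← FiniteField.pow_card x, hcard]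
    congr 1
    ring
  have hy2 : l ^ (p ^ n) ^ 2 = φ (φ l) := by rw [← hφ, ← hφ, sq, pow_mul]
  have hl3' : φ (φ (φ l)) = l := by
    rw [← hy2, ← hφ, ← pow_mul, ← pow_succ, hl3]
  rw [pow_add, pow_add, pow_one, hy2, hφ] at hl
  rw [pow_add, hy2, hφ l]
  rw [hφ] at hcφ
  intro T
  rw [hφ]
  have hsol : φ ((c + φ (φ l) * φ l * (c + 2) - c * φ (φ l)) / 2) +
      c * l * ((c + φ (φ l) * φ l * (c + 2) - c * φ (φ l)) / 2) - l = 0 := by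
    simp only [map_div₀, map_add, map_sub, map_mul, map_ofNat, hl3', hcφ]
    field_simp
    linear_combination (l - l * φ (φ l) + 1) * hc + (c ^ 2 + 2 * c) * hl
  refine ⟨fun hT => ?_, fun hT => hT ▸ hsol⟩
  set S := (c + φ (φ l) * φ l * (c + 2) - c * φ (φ l)) / 2
  rw [← sub_eq_zero]
  set D := T - S with hD
  have hD1 : φ D = -(c * l * D) := by
    rw [hD, map_sub]
    linear_combination hT - hsol
  have hD3 : φ (φ (φ D)) = c * D := by
    simp only [hD1, map_neg, map_mul, hcφ, map_sub, map_one]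
    linear_combination (-c * (-1 - c) * c * D) * hl + (c * D) * hc
  have hneg : D = -D := by
    conv_lhs => rw [← h6 D, hD3]
    simp only [map_mul, hD3, hcφ, map_sub, map_neg, map_one]
    linear_combination (-D) * hc
  exact (mul_eq_zero.1 (by linear_combination hneg : 2 * D = 0)).resolve_left h2
end

section
/- Let q be an odd prime power with q ≡ 2 or 3 (mod 5), and let c ∈ F_{q^6} satisfy c^2 + c = 1. Then there exist NO γ, β ∈ F_{q^6} satisfying simultaneously (c − γ)·( −(c − γ)^{q^4+q^2} + β^{q^5+q^4}·(c − γ)^{q^4+q^3+q^2} + β^{q^2+q} ) = 1 and γ = −(c − γ)^{q^2+1} + β^{q^3+q^2}·(c − γ)^{q^2+q+1}. -/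
/-- A root of `X ^ 2 + X - 1` of the form `t + t⁻¹`, so that `t ^ 5 = 1`, is sent to the other root by
the `p ^ k`-power Frobenius when `p ^ k ≡ ±2 (mod 5)`. -/
theorem pow_eq_conj_of_root {K : Type*} [Field K] (p k : ℕ) [Fact p.Prime] [CharP K p]
    (h5 : p ^ k % 5 = 2 ∨ p ^ k % 5 = 3) {c t : K} (hc : c ^ 2 + c = 1)
    (ht : t ^ 2 - c * t + 1 = 0) : c ^ (p ^ k) = -1 - c := by
  have ht0 : t ≠ 0 := by
    rintro rfl
    simp at ht
  obtain rfl : c = t + t⁻¹ := by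
    field_simp
    linear_combination -ht
  have hcyc : t ^ 4 + t ^ 3 + t ^ 2 + t + 1 = 0 := by
    field_simp at hc
    linear_combination hc
  have ht5 : t ^ 5 = 1 := by linear_combination (t - 1) * hcyc
  have hinv : t⁻¹ = t ^ 4 := by
    field_simp
    linear_combination -ht5
  have hmod (n : ℕ) : t ^ n = t ^ (n % 5) := by
    conv_lhs => rw [← Nat.div_add_mod n 5, pow_add, pow_mul, ht5, one_pow, one_mul]
  rw [add_pow_expChar_pow, inv_pow, hmod, hinv]
  rcases h5 with h | h <;> rw [h]
  · rw [inv_eq_of_mul_eq_one_right (a := t ^ 2) (b := t ^ 3) (by linear_combination ht5)]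
    linear_combination hcyc
  · rw [inv_eq_of_mul_eq_one_right (a := t ^ 3) (b := t ^ 2) (by linear_combination ht5)]
    linear_combination hcyc

/-- In characteristic `p`, the `p ^ k`-power Frobenius with `p ^ k ≡ ±2 (mod 5)` swaps the two roots
of `X ^ 2 + X - 1`. -/
theorem pow_eq_conj_of_mod_five {F : Type*} [Field F] (p k : ℕ) [Fact p.Prime] [CharP F p]
    (h5 : p ^ k % 5 = 2 ∨ p ^ k % 5 = 3) {c : F} (hc : c ^ 2 + c = 1) :
    c ^ (p ^ k) = -1 - c := by
  have hinj := (algebraMap F (AlgebraicClosure F)).injective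
  have : CharP (AlgebraicClosure F) p := charP_of_injective_algebraMap hinj p
  obtain ⟨t, ht⟩ := IsAlgClosed.exists_root (Polynomial.X ^ 2
      - Polynomial.C (algebraMap F (AlgebraicClosure F) c) * Polynomial.X + 1) (by
    rw [show (Polynomial.X ^ 2 - Polynomial.C (algebraMap F (AlgebraicClosure F) c)
      * Polynomial.X + 1 : Polynomial (AlgebraicClosure F)).degree = 2 by compute_degree!]
    decide)
  apply hinj
  rw [map_pow, map_sub, map_neg, map_one]
  refine pow_eq_conj_of_root p k h5 (t := t) ?_ (by simpa [Polynomial.IsRoot] using ht)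
  rw [← map_pow, ← map_add, hc, map_one]

section ProductIdentity

variable {F : Type*} [Field F]

/-- The difference of a product of three elements `A + c B` and its conjugate, where `c` and `d` are
the two roots of `X ^ 2 + X - 1`. -/
theorem prod_three_sub_conj {c d : F} (hc : c ^ 2 + c = 1) (hd : d = -1 - c)
    (A₁ A₂ A₃ B₁ B₂ B₃ : F) :
    (A₁ + c * B₁) * (A₂ + c * B₂) * (A₃ + c * B₃)
        - (A₁ + d * B₁) * (A₂ + d * B₂) * (A₃ + d * B₃)
      = (c - d) * (A₁ * A₂ * B₃ + A₁ * B₂ * A₃ + B₁ * A₂ * A₃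
          - (A₁ * B₂ * B₃ + B₁ * A₂ * B₃ + B₁ * B₂ * A₃) + 2 * (B₁ * B₂ * B₃)) := by
  subst hd
  linear_combination (2 * c + 1) * (B₁ * B₂ * B₃) * hc

/-- The numerator of `1 - c a + a a''` when `a` and `a''` are parametrized by `x`, `y`, `z` as in
`one_sub_mul_add_mul`. -/
def normNumerator (c d x y z : F) : F :=
  d ^ 2 + 2 * x - d * z + x * z + x * y - c * x ^ 2 * z

theorem one_sub_mul_add_mul {c d x y z a a' : F} (hc : c ^ 2 + c = 1) (hd : d = -1 - c)
    (h : x * y * z = 1) (ha : a * (d - x) = x * (y - c)) (ha' : a' * (d - z) = z * (x - c)) :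
    (1 - a * c + a * a') * ((d - x) * (d - z)) = normNumerator c d x y z := by
  have e : (1 - a * c + a * a') * ((d - x) * (d - z))
      = (d - x) * (d - z) - c * (d - z) * (a * (d - x)) + (a * (d - x)) * (a' * (d - z)) := by
    ring
  rw [e, ha, ha', normNumerator]
  subst hd
  linear_combination x * h + (x * y - c * x) * hc

theorem normNumerator_mul {c d x y z : F} (hc : c ^ 2 + c = 1) (hd : d = -1 - c)
    (h : x * y * z = 1) :
    normNumerator c d x y z * (y ^ 2 * z)
      = (y ^ 2 + (y * z) ^ 2 + 2 * (y * (y * z)) + 2 * y + y * z)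
        + c * ((y * z) ^ 2 - 1 + y * (y * z)) := by
  have hyz : y * z ≠ 0 := by
    intro h0
    apply one_ne_zero (α := F)
    rw [← h]
    linear_combination x * h0
  subst hd
  obtain rfl : x = (y * z)⁻¹ := eq_inv_of_mul_eq_one_left (by linear_combination h)
  have hy := left_ne_zero_of_mul hyz
  have hz := right_ne_zero_of_mul hyz
  unfold normNumerator
  field_simp
  linear_combination (y ^ 2 * z) * hc

theorem prod_normNumerator_sub_conj {c d x y z : F} (hc : c ^ 2 + c = 1) (hd : d = -1 - c)
    (h : x * y * z = 1) :
    normNumerator c d x y z * normNumerator c d z x y * normNumerator c d y z x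
        - normNumerator d c x y z * normNumerator d c z x y * normNumerator d c y z x
      = (c - d) * (2 * ((1 + x) * (1 + y) * (1 + z)) ^ 2) := by
  have hd' : d ^ 2 + d = 1 := by
    subst hd
    linear_combination hc
  have hcd : c = -1 - d := by linear_combination hd
  have hzx : z * x * y = 1 := by linear_combination h
  have hyz : y * z * x = 1 := by linear_combination h
  have e (c' d' : F) : normNumerator c' d' x y z * normNumerator c' d' z x y
      * normNumerator c' d' y z x = (normNumerator c' d' x y z * (y ^ 2 * z))
        * (normNumerator c' d' z x y * (x ^ 2 * y))
        * (normNumerator c' d' y z x * (z ^ 2 * x)) := by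
    linear_combination -(normNumerator c' d' x y z * normNumerator c' d' z x y
      * normNumerator c' d' y z x) * ((x * y * z) ^ 2 + x * y * z + 1) * h
  rw [e c d, e d c, normNumerator_mul hc hd h, normNumerator_mul hc hd hzx,
    normNumerator_mul hc hd hyz, normNumerator_mul hd' hcd h, normNumerator_mul hd' hcd hzx,
    normNumerator_mul hd' hcd hyz, prod_three_sub_conj hc hd]
  congr 1
  have hyz0 : y * z ≠ 0 := left_ne_zero_of_mul_eq_one hyz
  obtain rfl : x = (y * z)⁻¹ := eq_inv_of_mul_eq_one_left (by linear_combination h)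
  have hy := left_ne_zero_of_mul hyz0
  have hz := right_ne_zero_of_mul hyz0
  field_simp
  ring

theorem mul_denominators {w₀ w₁ w₂ w₃ w₄ w₅ s t : F} (h : w₀ * w₂ * w₄ * s = w₁ * w₃ * w₅ * t)
    (X Y Z X' Y' Z' : F) :
    (w₀ * (X' * Z')) * (w₂ * (Z' * Y')) * (w₄ * (Y' * X')) * (X * Y * Z) * (s * (X * Y * Z))
      = (w₁ * (Y * X)) * (w₃ * (X * Z)) * (w₅ * (Z * Y)) * (X' * Y' * Z')
        * (t * (X' * Y' * Z')) := by
  linear_combination ((X * Y * Z) * (X' * Y' * Z')) ^ 2 * h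

theorem prod_eq_prod_of_cyclic {g₀ g₃ g₄ g₅ e₀ e₁ e₂ n₀ n₁ n₂ a₀ a₁ a₂ : F} (h₀ : g₀ ≠ 0)
    (h₄ : g₄ ≠ 0) (h₅ : g₅ ≠ 0) (hg : g₀ = -(a₀ * a₁ * a₂) * g₃)
    (r₀ : g₄ * n₀ = a₀ * g₃ * e₁) (r₁ : g₅ * n₁ = a₁ * g₄ * e₂)
    (r₂ : g₀ * n₂ = a₂ * g₅ * -e₀) : n₀ * n₁ * n₂ = e₀ * e₁ * e₂ := by
  apply mul_left_cancel₀ (mul_ne_zero (mul_ne_zero h₄ h₅) h₀)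
  have e : g₄ * g₅ * g₀ * (n₀ * n₁ * n₂) = (g₄ * n₀) * (g₅ * n₁) * (g₀ * n₂) := by ring
  rw [e, r₀, r₁, r₂]
  linear_combination -(g₄ * g₅ * e₀ * e₁ * e₂) * hg

end ProductIdentity

/-- If `c - a` is minus the product of `a`, `φ a`, `φ (φ a)` and the third conjugate of `c - a`, then
`a` is parametrized by an element `x` with `x * φ x * φ (φ x) = 1`. -/
theorem exists_param_of_conj {F : Type*} [Field F] (φ : F →+* F) {c d : F} (hcd0 : c - d ≠ 0)
    (hφc : φ c = d) (hφd : φ d = c) {a₀ a₁ a₂ a₃ a₄ a₅ : F}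
    (ha₀ : φ a₀ = a₁) (ha₁ : φ a₁ = a₂) (ha₂ : φ a₂ = a₃) (ha₃ : φ a₃ = a₄) (ha₄ : φ a₄ = a₅)
    (ha₅ : φ a₅ = a₀) (G₀ : c - a₀ = -(a₀ * a₁ * a₂) * (d - a₃)) (hγ : c - a₀ ≠ 0) :
    ∃ x y z, φ x = y ∧ φ y = z ∧ φ z = x ∧ x * y * z = 1 ∧ d - x ≠ 0 ∧
      a₀ * (d - x) = x * (y - c) := by
  have hγ₃ : d - a₃ ≠ 0 := by
    intro h
    rw [h, mul_zero] at G₀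
    exact hγ G₀
  have hγ₄ : c - a₄ ≠ 0 := by rwa [← hφd, ← ha₃, ← map_sub, map_ne_zero]
  have hγ₅ : d - a₅ ≠ 0 := by rwa [← hφc, ← ha₄, ← map_sub, map_ne_zero]
  have G₁ := congrArg φ G₀
  simp only [map_sub, map_mul, map_neg, hφc, hφd, ha₀, ha₁, ha₂, ha₃] at G₁
  have hδ : (d - a₃) - (c - a₀) ≠ 0 := by
    intro h
    have e₀ : a₀ * a₁ * a₂ = -1 := by
      apply mul_right_cancel₀ hγ₃
      linear_combination G₀ + h
    have e₁ := congrArg φ e₀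
    simp only [map_mul, map_neg, map_one, ha₀, ha₁, ha₂] at e₁
    apply hcd0
    linear_combination -h - a₃ * e₀ + a₀ * e₁
  have hδ₁ : (c - a₄) - (d - a₁) ≠ 0 := by
    simpa only [map_sub, hφc, hφd, ha₀, ha₃] using (map_ne_zero φ).mpr hδ
  have hδ₂ : (d - a₅) - (c - a₂) ≠ 0 := by
    simpa only [map_sub, hφc, hφd, ha₁, ha₄] using (map_ne_zero φ).mpr hδ₁
  have R₀ : (c - a₄) * (d * a₀ - c * a₃) = a₀ * (d - a₃) * ((c - a₄) - (d - a₁)) := by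
    linear_combination -a₃ * (c - a₄) * G₀ + a₀ * (d - a₃) * G₁
  have R₁ := congrArg φ R₀
  simp only [map_sub, map_mul, hφc, hφd, ha₀, ha₁, ha₃, ha₄] at R₁
  have R₂ := congrArg φ R₁
  simp only [map_sub, map_mul, hφc, hφd, ha₁, ha₂, ha₄, ha₅] at R₂
  obtain ⟨x, hx⟩ : ∃ x, x * ((d - a₃) - (c - a₀)) = d * a₀ - c * a₃ :=
    ⟨_, div_mul_cancel₀ _ hδ⟩
  obtain ⟨y, hxy⟩ : ∃ y, φ x = y := ⟨_, rfl⟩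
  obtain ⟨z, hyz⟩ : ∃ z, φ y = z := ⟨_, rfl⟩
  have hy := congrArg φ hx
  simp only [map_sub, map_mul, hφc, hφd, ha₀, ha₃, hxy] at hy
  have hz := congrArg φ hy
  simp only [map_sub, map_mul, hφc, hφd, ha₁, ha₄, hyz] at hz
  have hzx : φ z = x := by
    have h := congrArg φ hz
    simp only [map_sub, map_mul, hφc, hφd, ha₂, ha₅] at h
    apply mul_right_cancel₀ hδ
    linear_combination -h - hx
  have hxyz : x * y * z = 1 := by
    have e' := prod_eq_prod_of_cyclic hγ hγ₄ hγ₅ G₀ R₀ R₁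
      (e₀ := (d - a₃) - (c - a₀)) (by rw [R₂]; ring)
    rw [← hx, ← hy, ← hz] at e'
    apply mul_right_cancel₀ (mul_ne_zero (mul_ne_zero hδ hδ₁) hδ₂)
    linear_combination e'
  have hdx : d - x ≠ 0 := by
    intro h
    apply mul_ne_zero hcd0 hγ₃
    linear_combination -((d - a₃) - (c - a₀)) * h - hx
  refine ⟨x, y, z, hxy, hyz, hzx, hxyz, hdx, ?_⟩
  apply mul_right_cancel₀ (mul_ne_zero hδ hδ₁)
  linear_combination -((a₀ + y - c) * ((c - a₄) - (d - a₁))) * hx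
    - (d * a₀ - c * a₃) * hy - (d - c) * R₀

theorem param_conj_false {F : Type*} [Field F] (φ : F →+* F) (h2 : (2 : F) ≠ 0) {c d : F}
    (hc : c ^ 2 + c = 1) (hd : d = -1 - c) (hcd0 : c - d ≠ 0) (hφc : φ c = d) (hφd : φ d = c)
    {a₀ a₁ a₂ a₃ a₄ a₅ x y z : F}
    (ha₀ : φ a₀ = a₁) (ha₁ : φ a₁ = a₂) (ha₂ : φ a₂ = a₃) (ha₃ : φ a₃ = a₄) (ha₄ : φ a₄ = a₅)
    (hW : (1 - a₀ * c + a₀ * a₂) * (1 - a₂ * c + a₂ * a₄) * (1 - a₄ * c + a₄ * a₀)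
        * (a₁ * a₃ * a₅)
      = (1 - a₁ * d + a₁ * a₃) * (1 - a₃ * d + a₃ * a₅) * (1 - a₅ * d + a₅ * a₁)
        * (a₀ * a₂ * a₄))
    (hxy : φ x = y) (hyz : φ y = z) (hzx : φ z = x) (hxyz : x * y * z = 1) (hdx : d - x ≠ 0)
    (A₀ : a₀ * (d - x) = x * (y - c)) : False := by
  have hcd : c = -1 - d := by linear_combination hd
  have hd' : d ^ 2 + d = 1 := by
    subst hd
    linear_combination hc
  have A₁ := congrArg φ A₀
  simp only [map_sub, map_mul, hφc, hφd, ha₀, hxy, hyz] at A₁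
  have A₂ := congrArg φ A₁
  simp only [map_sub, map_mul, hφc, hφd, ha₁, hzx, hyz] at A₂
  have A₃ := congrArg φ A₂
  simp only [map_sub, map_mul, hφc, hφd, ha₂, hzx, hxy] at A₃
  have A₄ := congrArg φ A₃
  simp only [map_sub, map_mul, hφc, hφd, ha₃, hxy, hyz] at A₄
  have A₅ := congrArg φ A₄
  simp only [map_sub, map_mul, hφc, hφd, ha₄, hyz, hzx] at A₅
  have hcy : c - y ≠ 0 := by rwa [← hφd, ← hxy, ← map_sub, map_ne_zero]
  have hdz : d - z ≠ 0 := by rwa [← hφc, ← hyz, ← map_sub, map_ne_zero]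
  have hcx : c - x ≠ 0 := by rwa [← hφd, ← hzx, ← map_sub, map_ne_zero]
  have hdy : d - y ≠ 0 := by rwa [← hφc, ← hxy, ← map_sub, map_ne_zero]
  have hcz : c - z ≠ 0 := by rwa [← hφd, ← hyz, ← map_sub, map_ne_zero]
  have hzxy : z * x * y = 1 := by linear_combination hxyz
  have hyzx : y * z * x = 1 := by linear_combination hxyz
  have K₀ := one_sub_mul_add_mul hc hd hxyz A₀ A₂
  have K₂ := one_sub_mul_add_mul hc hd hzxy A₂ A₄
  have K₄ := one_sub_mul_add_mul hc hd hyzx A₄ A₀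
  have K₁ := one_sub_mul_add_mul hd' hcd hyzx A₁ A₃
  have K₃ := one_sub_mul_add_mul hd' hcd hxyz A₃ A₅
  have K₅ := one_sub_mul_add_mul hd' hcd hzxy A₅ A₁
  have hsub := prod_normNumerator_sub_conj hc hd hxyz
  have B : a₁ * a₃ * a₅ * ((c - x) * (c - y) * (c - z)) = -((d - x) * (d - y) * (d - z)) := by
    have e : a₁ * a₃ * a₅ * ((c - x) * (c - y) * (c - z))
        = (a₁ * (c - y)) * (a₃ * (c - x)) * (a₅ * (c - z)) := by ring
    rw [e, A₁, A₃, A₅]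
    linear_combination -((d - x) * (d - y) * (d - z)) * hxyz
  have B' : a₀ * a₂ * a₄ * ((d - x) * (d - y) * (d - z)) = -((c - x) * (c - y) * (c - z)) := by
    have e : a₀ * a₂ * a₄ * ((d - x) * (d - y) * (d - z))
        = (a₀ * (d - x)) * (a₂ * (d - z)) * (a₄ * (d - y)) := by ring
    rw [e, A₀, A₂, A₄]
    linear_combination -((c - x) * (c - y) * (c - z)) * hxyz
  have hprod : normNumerator c d x y z * normNumerator c d z x y * normNumerator c d y z x
      = normNumerator d c x y z * normNumerator d c z x y * normNumerator d c y z x := by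
    apply mul_right_cancel₀ (mul_ne_zero (mul_ne_zero (mul_ne_zero hcx hcy) hcz)
      (mul_ne_zero (mul_ne_zero hdx hdy) hdz))
    have e := mul_denominators hW (c - x) (c - y) (c - z) (d - x) (d - y) (d - z)
    rw [K₀, K₂, K₄, K₁, K₃, K₅, B, B'] at e
    linear_combination -e
  rw [hprod, sub_self] at hsub
  have hx1 : 1 + x ≠ 0 := by
    intro h
    have h' := congrArg φ h
    simp only [map_add, map_one, map_zero, hxy] at h'
    have h'' := congrArg φ h'
    simp only [map_add, map_one, map_zero, hyz] at h''
    apply h2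
    linear_combination -hxyz + y * z * h - z * h' + h''
  have hy1 : 1 + y ≠ 0 := by rwa [← hxy, ← map_one φ, ← map_add, map_ne_zero]
  have hz1 : 1 + z ≠ 0 := by rwa [← hyz, ← map_one φ, ← map_add, map_ne_zero]
  exact mul_ne_zero hcd0 (mul_ne_zero h2 (pow_ne_zero 2 (mul_ne_zero (mul_ne_zero hx1 hy1) hz1)))
    hsub.symm

/-- The system has no solution in a field with an automorphism of order dividing six that swaps the
roots of `X ^ 2 + X - 1`; the `aᵢ` and `bᵢ` are the conjugates of `c - γ` and `β`. -/
theorem conj_system_unsolvable {F : Type*} [Field F] (φ : F →+* F) (h2 : (2 : F) ≠ 0)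
    (h5 : (5 : F) ≠ 0) {c d : F} (hc : c ^ 2 + c = 1) (hd : d = -1 - c) (hφc : φ c = d)
    {a₀ a₁ a₂ a₃ a₄ a₅ b₀ b₁ b₂ b₃ b₄ b₅ : F}
    (ha₀ : φ a₀ = a₁) (ha₁ : φ a₁ = a₂) (ha₂ : φ a₂ = a₃) (ha₃ : φ a₃ = a₄) (ha₄ : φ a₄ = a₅)
    (ha₅ : φ a₅ = a₀) (hb₀ : φ b₀ = b₁) (hb₁ : φ b₁ = b₂) (hb₂ : φ b₂ = b₃) (hb₃ : φ b₃ = b₄)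
    (hb₄ : φ b₄ = b₅) (hb₅ : φ b₅ = b₀)
    (H₁ : a₀ * (-(a₄ * a₂) + b₅ * b₄ * (a₄ * a₃ * a₂) + b₂ * b₁) = 1)
    (H₂ : c - a₀ = -(a₂ * a₀) + b₃ * b₂ * (a₂ * a₁ * a₀)) : False := by
  have hφd : φ d = c := by
    rw [hd, map_sub, map_neg, map_one, hφc, hd]
    ring
  have hcd0 : c - d ≠ 0 := by
    intro h
    apply h5
    subst hd
    linear_combination (2 * c + 1) * h - 4 * hc
  have H₂₁ := congrArg φ H₂
  simp only [map_add, map_sub, map_mul, map_neg, hφc, ha₀, ha₁, ha₂, hb₂, hb₃] at H₂₁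
  have H₂₂ := congrArg φ H₂₁
  simp only [map_add, map_sub, map_mul, map_neg, hφd, ha₁, ha₂, ha₃, hb₃, hb₄] at H₂₂
  have W₀ : a₀ * (b₂ * b₁) = 1 - a₀ * c + a₀ * a₂ := by
    linear_combination H₁ + a₀ * H₂₂
  have W₁ := congrArg φ W₀
  simp only [map_add, map_sub, map_mul, map_one, hφc, ha₀, ha₂, hb₁, hb₂] at W₁
  have W₂ := congrArg φ W₁
  simp only [map_add, map_sub, map_mul, map_one, hφd, ha₁, ha₃, hb₂, hb₃] at W₂
  have W₃ := congrArg φ W₂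
  simp only [map_add, map_sub, map_mul, map_one, hφc, ha₂, ha₄, hb₃, hb₄] at W₃
  have W₄ := congrArg φ W₃
  simp only [map_add, map_sub, map_mul, map_one, hφd, ha₃, ha₅, hb₄, hb₅] at W₄
  have W₅ := congrArg φ W₄
  simp only [map_add, map_sub, map_mul, map_one, hφc, ha₄, ha₀, hb₅, hb₀] at W₅
  have hW : (1 - a₀ * c + a₀ * a₂) * (1 - a₂ * c + a₂ * a₄) * (1 - a₄ * c + a₄ * a₀)
        * (a₁ * a₃ * a₅)
      = (1 - a₁ * d + a₁ * a₃) * (1 - a₃ * d + a₃ * a₅) * (1 - a₅ * d + a₅ * a₁)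
        * (a₀ * a₂ * a₄) := by
    rw [← W₀, ← W₁, ← W₂, ← W₃, ← W₄, ← W₅]
    ring
  have G₀ : c - a₀ = -(a₀ * a₁ * a₂) * (d - a₃) := by
    linear_combination H₂ + a₀ * a₂ * W₁
  by_cases hγ : c - a₀ = 0
  · obtain rfl : a₀ = c := by linear_combination -hγ
    obtain rfl : d = a₁ := by rw [← ha₀, hφc]
    obtain rfl : a₀ = a₂ := by rw [← ha₁, hφd]
    obtain rfl : d = a₃ := by rw [← ha₂, hφc]
    obtain rfl : a₀ = a₄ := by rw [← ha₃, hφd]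
    obtain rfl : d = a₅ := by rw [← ha₄, hφc]
    apply mul_ne_zero h2 hcd0
    subst hd
    linear_combination -hW - (2 * a₀ + 1) * hc
  obtain ⟨x, y, z, hxy, hyz, hzx, hxyz, hdx, A₀⟩ :=
    exists_param_of_conj φ hcd0 hφc hφd ha₀ ha₁ ha₂ ha₃ ha₄ ha₅ G₀ hγ
  exact param_conj_false φ h2 hc hd hcd0 hφc hφd ha₀ ha₁ ha₂ ha₃ ha₄ hW hxy hyz hzx hxyz hdx A₀

theorem stmt7 (q : ℕ) (hq : IsPrimePow q) (hodd : Odd q)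
    (hq5 : q % 5 = 2 ∨ q % 5 = 3)
    (F : Type*) [Field F] [Fintype F] (hcard : Fintype.card F = q ^ 6)
    (c : F) (hc : c ^ 2 + c = 1) :
    ¬ ∃ γ β : F,
        (c - γ) * (-(c - γ) ^ (q ^ 4 + q ^ 2)
            + β ^ (q ^ 5 + q ^ 4) * (c - γ) ^ (q ^ 4 + q ^ 3 + q ^ 2)
            + β ^ (q ^ 2 + q)) = 1 ∧
        γ = -(c - γ) ^ (q ^ 2 + 1) + β ^ (q ^ 3 + q ^ 2) * (c - γ) ^ (q ^ 2 + q + 1) := by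
  rintro ⟨γ, β, H₁, H₂⟩
  obtain ⟨p, k, hp, hk, rfl⟩ := (isPrimePow_nat_iff q).mp hq
  have : Fact p.Prime := ⟨hp⟩
  have hchar : CharP F p := charP_of_card_eq_prime_pow (f := k * 6) (by rw [hcard, pow_mul])
  have h2 : (2 : F) ≠ 0 := by
    intro h
    have h' : p ∣ 2 := (CharP.cast_eq_zero_iff F p 2).mp (by exact_mod_cast h)
    rw [(Nat.prime_dvd_prime_iff_eq hp Nat.prime_two).mp h'] at hodd
    exact Nat.not_odd_iff_even.mpr (even_two.pow_of_ne_zero hk.ne') hodd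
  have h5 : (5 : F) ≠ 0 := by
    intro h
    have h' : p ∣ 5 := (CharP.cast_eq_zero_iff F p 5).mp (by exact_mod_cast h)
    have h'' := (Nat.prime_dvd_prime_iff_eq hp Nat.prime_five).mp h'
    have hdvd : 5 ∣ p ^ k := h'' ▸ dvd_pow_self p hk.ne'
    omega
  have hφc : c ^ p ^ k = -1 - c := pow_eq_conj_of_mod_five p k hq5 hc
  obtain ⟨φ, hφ⟩ : ∃ φ : F →+* F, ∀ x, φ x = x ^ p ^ k :=
    ⟨iterateFrobenius F p k, iterateFrobenius_def p k⟩
  generalize p ^ k = q at *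
  have h₁ (x : F) : φ (x ^ q) = x ^ q ^ 2 := by rw [hφ, ← pow_mul, sq]
  have hi (x : F) (i : ℕ) : φ (x ^ q ^ i) = x ^ q ^ (i + 1) := by
    rw [hφ, ← pow_mul, ← pow_succ]
  have h₅ (x : F) : φ (x ^ q ^ 5) = x := by rw [hi, ← hcard, FiniteField.pow_card]
  simp only [pow_add, pow_one] at H₁ H₂
  refine conj_system_unsolvable φ h2 h5 hc rfl ((hφ c).trans hφc) (hφ (c - γ)) (h₁ _) (hi _ 2)
    (hi _ 3) (hi _ 4) (h₅ _) (hφ β) (h₁ _) (hi _ 2) (hi _ 3) (hi _ 4) (h₅ _) ?_ ?_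
  · linear_combination H₁
  · linear_combination H₂
end

section
/- Let q be an even prime power and let c ∈ F_{q^6} satisfy c^2 + c = 1. Then there exist α, β ∈ F_{q^6}, both nonzero, such that (α, β, γ = 0) satisfies all equations of System (1); explicitly: c^{(q^6−1)/(q−1)} = 1; c·( c^{q^4+q^2} + β^{q^5+q^4}·c^{q^4+q^3+q^2} + β^{q^2+q} ) = 1; α = c^{q+1}·β^{q^2}; c^{q^2+1} + β^{q^3+q^2}·c^{q^2+q+1} = 0; and β = c^{q^3+q^2+1}·β^{q^4} + β^{q^2}·c^{q^3+q+1} + β^{q^4+q^3+q^2}·c^{q^3+q^2+q+1}. (Consequently, for q even the code C = ⟨x, x^q + x^{q^3} + c x^{q^5}⟩_{F_{q^6}} is not an MRD-code.) -/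
/-- In a finite field, every cube root of unity is a `d`-th power as soon as `3 * d` divides
the order of the multiplicative group. -/
theorem exists_pow_eq_of_cube_eq_one {F : Type*} [Field F] [Fintype F] {d : ℕ}
    (hd : d * 3 ∣ Fintype.card F - 1) {c : F} (hc : c ^ 3 = 1) : ∃ b : F, b ^ d = c := by
  classical
  have hc0 : c ≠ 0 := by
    rintro rfl
    simp at hc
  obtain ⟨g, hg⟩ := IsCyclic.exists_generator (α := Fˣ)
  obtain ⟨k, hk⟩ := (mem_powers_iff_mem_zpowers).2 (hg (Units.mk0 c hc0))
  have hk' : g ^ k = Units.mk0 c hc0 := hk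
  have h1 : g ^ (k * 3) = 1 := by
    rw [pow_mul, hk']
    ext
    simpa using hc
  have h2 : Fintype.card F - 1 ∣ k * 3 := by
    rw [← Fintype.card_units, ← Nat.card_eq_fintype_card,
      ← orderOf_eq_card_of_forall_mem_zpowers hg]
    exact orderOf_dvd_of_pow_eq_one h1
  obtain ⟨m, rfl⟩ := Nat.dvd_of_mul_dvd_mul_right (by norm_num) (hd.trans h2)
  refine ⟨(g ^ m : Fˣ), ?_⟩
  rw [← Units.val_pow_eq_pow_val, ← pow_mul, mul_comm, hk', Units.val_mk0]

theorem three_mul_succ_dvd_pow_six_sub_one {q : ℕ} (h : q % 3 = 2) :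
    (q + 1) * 3 ∣ q ^ 6 - 1 := by
  obtain ⟨k, rfl⟩ : ∃ k, q = 3 * k + 2 := ⟨q / 3, by omega⟩
  obtain ⟨m, hm⟩ : ∃ m, (3 * k + 2) ^ 4 + (3 * k + 2) ^ 2 + 1 = 3 * m :=
    ⟨27 * k ^ 4 + 72 * k ^ 3 + 75 * k ^ 2 + 36 * k + 7, by ring⟩
  refine ⟨(3 * k + 1) * m, Nat.sub_eq_of_eq_add ?_⟩
  linear_combination (3 * k + 3) * (3 * k + 1) * hm


theorem stmt10 (q : ℕ) (hq : IsPrimePow q) (heven : Even q)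
    (F : Type*) [Field F] [Fintype F] (hcard : Fintype.card F = q ^ 6)
    (c : F) (hc : c ^ 2 + c = 1) :
    ∃ α β : F, α ≠ 0 ∧ β ≠ 0 ∧
      c ^ ((q ^ 6 - 1) / (q - 1)) = 1 ∧
      c * (c ^ (q ^ 4 + q ^ 2)
          + β ^ (q ^ 5 + q ^ 4) * c ^ (q ^ 4 + q ^ 3 + q ^ 2)
          + β ^ (q ^ 2 + q)) = 1 ∧
      α = c ^ (q + 1) * β ^ (q ^ 2) ∧
      c ^ (q ^ 2 + 1) + β ^ (q ^ 3 + q ^ 2) * c ^ (q ^ 2 + q + 1) = 0 ∧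
      β = c ^ (q ^ 3 + q ^ 2 + 1) * β ^ (q ^ 4)
          + β ^ (q ^ 2) * c ^ (q ^ 3 + q + 1)
          + β ^ (q ^ 4 + q ^ 3 + q ^ 2) * c ^ (q ^ 3 + q ^ 2 + q + 1) := by
  obtain ⟨p, k, hp, -, rfl⟩ := (isPrimePow_nat_iff _).1 hq
  obtain rfl : 2 = p :=
    (Nat.prime_dvd_prime_iff_eq Nat.prime_two hp).1 (Nat.prime_two.dvd_of_dvd_pow heven.two_dvd)
  have h2 : (2 : F) = 0 := by
    have h := Nat.cast_card_eq_zero F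
    rw [hcard] at h
    push_cast at h
    exact eq_zero_of_pow_eq_zero (eq_zero_of_pow_eq_zero h)
  have hq3 : 2 ^ k % 3 = 1 ∨ 2 ^ k % 3 = 2 := by
    have h : ¬ 3 ∣ 2 ^ k := fun h => by
      have := Nat.prime_three.dvd_of_dvd_pow h
      omega
    omega
  have hq2 : 2 ≤ 2 ^ k := hq.two_le
  generalize 2 ^ k = q at *
  have hsum : (q ^ 6 - 1) / (q - 1) = 1 + q + q ^ 2 + q ^ 3 + q ^ 4 + q ^ 5 := by
    rw [← Nat.geomSum_eq hq2]
    simp [Finset.sum_range_succ]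
  have c3 : c ^ 3 = 1 := by linear_combination (c - 1) * hc + (c - 1) * h2
  have hc0 : c ≠ 0 := by
    rintro rfl
    simp at hc
  have succ (x : F) (n : ℕ) : x ^ q ^ (n + 1) = (x ^ q ^ n) ^ q := by rw [pow_succ, pow_mul]
  rw [hsum]
  obtain hq3 | hq3 := hq3
  · have e1 : c ^ q = c := by rw [pow_eq_pow_mod q c3, hq3, pow_one]
    have e (n : ℕ) : c ^ q ^ n = c := by
      induction n with
      | zero => simp
      | succ n ih => rw [succ, ih, e1]
    refine ⟨_, c, ?_, hc0, ?_, ?_, rfl, ?_, ?_⟩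
    · exact mul_ne_zero (pow_ne_zero _ hc0) (pow_ne_zero _ hc0)
    all_goals simp only [pow_add, e, e1, pow_one]
    · linear_combination (c ^ 3 + 1) * c3
    · grind
    · grind
    · grind
  · have e1 : c ^ q = c ^ 2 := by rw [pow_eq_pow_mod q c3, hq3]
    have e2 : c ^ q ^ 2 = c := by rw [succ, pow_one, e1, pow_right_comm, e1]; grind
    have e3 : c ^ q ^ 3 = c ^ 2 := by rw [succ, e2, e1]
    have e4 : c ^ q ^ 4 = c := by rw [succ, e3, pow_right_comm, e1]; grind
    have e5 : c ^ q ^ 5 = c ^ 2 := by rw [succ, e4, e1]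
    obtain ⟨b, hb⟩ := exists_pow_eq_of_cube_eq_one
      (hcard ▸ three_mul_succ_dvd_pow_six_sub_one hq3) c3
    have hb0 : b ≠ 0 := by
      rintro rfl
      simp at hb
      exact hc0 hb.symm
    have hb1 : b ^ q * b = c := by rw [← pow_succ, hb]
    have b2 : b ^ q ^ 2 = c * b := by
      have h : b ^ q ^ 2 * b ^ q = c ^ 2 := by rw [succ, pow_one, ← mul_pow, hb1, e1]
      refine mul_right_cancel₀ (pow_ne_zero q hb0) ?_
      linear_combination h - c * hb1
    have b3 : b ^ q ^ 3 = c ^ 2 * b ^ q := by rw [succ, b2, mul_pow, e1]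
    have b4 : b ^ q ^ 4 = c ^ 2 * b := by
      rw [succ, b3, mul_pow, pow_right_comm, e1, ← pow_mul b, ← pow_two q, b2]
      grind
    have b5 : b ^ q ^ 5 = c * b ^ q := by
      rw [succ, b4, mul_pow, pow_right_comm, e1]
      grind
    refine ⟨_, b, ?_, hb0, ?_, ?_, rfl, ?_, ?_⟩
    · exact mul_ne_zero (pow_ne_zero _ hc0) (pow_ne_zero _ hb0)
    all_goals simp only [pow_add, e1, e2, e3, e4, e5, b2, b3, b4, b5, pow_one]
    · linear_combination (c ^ 6 + c ^ 3 + 1) * c3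
    all_goals
      generalize b ^ q = d at *
      grind
end

section
/- Let q be an odd prime power and let c ∈ F_{q^6} satisfy c^2 + c = 1. Let C be the set of F_q-linear maps {x ↦ αx + β(x^q + x^{q^3} + c·x^{q^5}) : α, β ∈ F_{q^6}}. Then an F_q-linear map φ : F_{q^6} → F_{q^6} satisfies g ∘ φ ∈ C for every g ∈ C if and only if there exists a ∈ F_{q^6} with a^{q^2} = a such that φ(x) = a·x for all x. In particular the right idealiser R(C) is a field isomorphic to F_{q^2}. -/
/-- The powers `x ↦ x ^ q ^ i`, `i < 6`, are linearly independent over a field with `q ^ 6`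
elements. -/
theorem coeff_eq_zero_of_sum_mul_pow_pow_eq_zero {F : Type*} [Field F] [Fintype F] {q n : ℕ}
    (hq : 1 < q) (hcard : Fintype.card F = q ^ n) (k : Fin n → F)
    (h : ∀ x : F, ∑ i, k i * x ^ q ^ (i : ℕ) = 0) (i : Fin n) : k i = 0 := by
  classical
  set P : Polynomial F :=
    ∑ i : Fin n, Polynomial.C (k i) * Polynomial.X ^ q ^ (i : ℕ) with hP
  have hdeg : P.degree < (q ^ n : ℕ) := by
    refine (Polynomial.degree_sum_le _ _).trans_lt ?_
    rw [Finset.sup_lt_iff (WithBot.bot_lt_coe _)]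
    intro j _
    refine (Polynomial.degree_C_mul_X_pow_le _ _).trans_lt ?_
    exact_mod_cast Nat.pow_lt_pow_right hq j.2
  have hP0 : P = 0 := by
    refine Polynomial.eq_zero_of_degree_lt_of_eval_finset_eq_zero Finset.univ ?_ ?_
    · rwa [Finset.card_univ, hcard]
    · intro x _
      simpa [hP, Polynomial.eval_finsetSum] using h x
  have hc : P.coeff (q ^ (i : ℕ)) = k i := by
    simp only [hP, Polynomial.finsetSum_coeff, Polynomial.coeff_C_mul_X_pow]
    rw [Finset.sum_eq_single i]
    · simp
    · intro j _ hj
      rw [if_neg]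
      intro h'
      exact hj (Fin.ext (Nat.pow_right_injective hq h').symm)
    · simp
  rw [← hc, hP0, Polynomial.coeff_zero]

/-- A triple `u, v, w` whose cyclically consecutive members satisfy `r * v = s * w` vanishes unless
 `r ^ 3 = s ^ 3`. -/
theorem eq_zero_of_cyclic_proportional {F : Type*} [Field F] {r s u v w : F}
    (h : r ^ 3 ≠ s ^ 3) (h₁ : r * v = s * w) (h₂ : r * w = s * u) (h₃ : r * u = s * v) :
    u = 0 := by
  have : (r ^ 3 - s ^ 3) * u = 0 := by
    linear_combination r ^ 2 * h₃ + r * s * h₁ + s ^ 2 * h₂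
  exact (mul_eq_zero.mp this).resolve_left (sub_ne_zero.mpr h)

theorem eq_zero_of_endomorphism_relations {F : Type*} [Field F] (h2 : (2 : F) ≠ 0)
    (σ : F →+* F) (hσ : ∀ x, σ (σ (σ (σ (σ (σ x))))) = x) {c b : F} (hc : c ^ 2 + c = 1)
    (h₁ : σ b + σ (σ (σ b)) * σ (σ (σ c)) + c * σ (σ (σ (σ (σ b)))) = 0)
    (h₂ : σ b + σ (σ (σ b)) + c * (σ (σ (σ (σ (σ b)))) * σ (σ (σ (σ (σ c))))) = 0) :
    b = 0 := by
  have hd : σ c ^ 2 + σ c = 1 := by simpa using congrArg σ hc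
  have hor : (σ c - c) * (σ c + c + 1) = 0 := by linear_combination hd - hc
  rw [← map_eq_zero σ]
  rcases mul_eq_zero.mp hor with h | h
  · have hfix : σ c = c := sub_eq_zero.mp h
    simp only [hfix] at h₁ h₂
    have hc1 : c - 1 ≠ 0 := by
      intro h'
      have : (1 : F) = 0 := by linear_combination hc - (c + 2) * h'
      exact one_ne_zero this
    have key : 1 * σ (σ (σ b)) = c * σ (σ (σ (σ (σ b)))) := by
      refine mul_left_cancel₀ hc1 ?_
      linear_combination h₁ - h₂
    have key₂ := congrArg (fun x => σ (σ x)) key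
    have key₃ := congrArg (fun x => σ (σ x)) key₂
    simp only [map_mul, map_one, hfix, hσ] at key₂ key₃
    refine eq_zero_of_cyclic_proportional ?_ key key₂ key₃
    intro h'
    refine mul_ne_zero h2 hc1 ?_
    linear_combination (1 - c) * hc - h'
  · have hfix : σ c = -1 - c := by linear_combination h
    simp only [hfix, map_sub, map_neg, map_one, sub_sub_cancel] at h₁ h₂
    have key : (c + 2) * σ (σ (σ b)) = (c + 1) * σ (σ (σ (σ (σ b)))) := by
      linear_combination h₂ - h₁ + σ (σ (σ (σ (σ b)))) * hc
    have key₂ := congrArg (fun x => σ (σ x)) key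
    have key₃ := congrArg (fun x => σ (σ x)) key₂
    have hfix₂ : σ (σ c) = c := by rw [hfix, map_sub, map_neg, map_one, hfix]; ring
    simp only [map_mul, map_add, map_one, map_ofNat, hfix₂, hσ] at key₂ key₃
    refine eq_zero_of_cyclic_proportional ?_ key key₂ key₃
    intro h'
    have h3 : 3 * c + 5 = 0 := by
      refine (mul_eq_zero.mp ?_).resolve_left h2
      linear_combination h' - 3 * hc
    have : (1 : F) = 0 := by linear_combination 9 * hc - (3 * c - 2) * h3
    exact one_ne_zero this

theorem stmt12 (q : ℕ) (hq : IsPrimePow q) (hodd : Odd q)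
    (F : Type*) [Field F] [Fintype F] (hcard : Fintype.card F = q ^ 6)
    (c : F) (hc : c ^ 2 + c = 1)
    (φ : F → F)
    (hadd : ∀ x y : F, φ (x + y) = φ x + φ y)
    (hsmul : ∀ t x : F, t ^ q = t → φ (t * x) = t * φ x) :
    (∀ α β : F, ∃ α' β' : F, ∀ x : F,
        α * φ x + β * ((φ x) ^ q + (φ x) ^ (q ^ 3) + c * (φ x) ^ (q ^ 5))
          = α' * x + β' * (x ^ q + x ^ (q ^ 3) + c * x ^ (q ^ 5)))
      ↔ ∃ a : F, a ^ (q ^ 2) = a ∧ ∀ x : F, φ x = a * x := by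
  have hq1 : 1 < q := hq.one_lt
  have h2 : (2 : F) ≠ 0 := by
    refine Ring.two_ne_zero fun h => ?_
    have := FiniteField.even_card_iff_char_two.mp h
    rw [hcard, ← Nat.even_iff] at this
    exact Nat.not_even_iff_odd.mpr hodd.pow this
  obtain ⟨σ, hσ⟩ : ∃ σ : F →+* F, ∀ x, σ x = x ^ q := by
    obtain ⟨p, k, hp, _, rfl⟩ := hq
    have : Fact p.Prime := ⟨hp.nat_prime⟩
    have : CharP F p :=
      charP_of_card_eq_prime_pow (f := k * 6) (by rw [hcard, pow_mul])
    exact ⟨iterateFrobenius F p k, fun x => iterateFrobenius_def p k x⟩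
  have e1 : ∀ x : F, x ^ q = σ x := fun x => (hσ x).symm
  have e2 : ∀ x : F, x ^ q ^ 2 = σ (σ x) := fun x => by rw [pow_succ, pow_mul, pow_one, e1, e1]
  have e3 : ∀ x : F, x ^ q ^ 3 = σ (σ (σ x)) := fun x => by rw [pow_succ, pow_mul, e2, e1]
  have e4 : ∀ x : F, x ^ q ^ 4 = σ (σ (σ (σ x))) := fun x => by rw [pow_succ, pow_mul, e3, e1]
  have e5 : ∀ x : F, x ^ q ^ 5 = σ (σ (σ (σ (σ x)))) := fun x => by
    rw [pow_succ, pow_mul, e4, e1]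
  have e6 : ∀ x : F, σ (σ (σ (σ (σ (σ x))))) = x := fun x => by
    rw [← e5, ← e1, ← pow_mul, ← pow_succ', ← hcard, FiniteField.pow_card]
  simp only [e1, e2, e3, e5]
  constructor
  · intro h
    obtain ⟨a, b, hab⟩ := h 1 0
    obtain ⟨a', b', hab'⟩ := h 0 1
    simp only [one_mul, zero_mul, add_zero, zero_add] at hab hab'
    have hk := coeff_eq_zero_of_sum_mul_pow_pow_eq_zero hq1 hcard
      ![σ b * σ c + σ (σ (σ b)) + c * σ (σ (σ (σ (σ b)))) - a',
        σ a - b',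
        σ b + σ (σ (σ b)) * σ (σ (σ c)) + c * σ (σ (σ (σ (σ b)))),
        σ (σ (σ a)) - b',
        σ b + σ (σ (σ b)) + c * (σ (σ (σ (σ (σ b)))) * σ (σ (σ (σ (σ c))))),
        c * σ (σ (σ (σ (σ a)))) - b' * c] (fun x => by
          have := hab' x
          simp only [hab, map_add, map_mul, e6] at this
          simp only [Fin.sum_univ_succ, Fin.sum_univ_zero]
          simp [e1, e2, e3, e4, e5]
          linear_combination this)
    have hb : b = 0 := eq_zero_of_endomorphism_relations h2 σ e6 hc (hk 2) (hk 4)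
    have ha1 : σ a - b' = 0 := hk 1
    have ha3 : σ (σ (σ a)) - b' = 0 := hk 3
    refine ⟨a, σ.injective ?_, fun x => by simp [hab, hb]⟩
    linear_combination ha3 - ha1
  · rintro ⟨a, ha, hφ⟩ α β
    refine ⟨α * a, β * σ a, fun x => ?_⟩
    simp only [hφ, map_mul, ha]
    ring
end

section
/- Let q be an odd prime power and let c ∈ F_{q^6} satisfy c^2 + c = 1. Let C be the set of F_q-linear maps {x ↦ αx + β(x^q + x^{q^3} + c·x^{q^5}) : α, β ∈ F_{q^6}}. Then an F_q-linear map φ : F_{q^6} → F_{q^6} satisfies φ ∘ g ∈ C for every g ∈ C if and only if there exists a ∈ F_{q^6} such that φ(x) = a·x for all x. In particular the left idealiser L(C) is a field isomorphic to F_{q^6}. -/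
open Polynomial in
/-- Over a field with `q ^ 6` elements, the functions `x`, `x ^ q`, `x ^ (q ^ 3)`, `x ^ (q ^ 5)`
are linearly independent; we record the vanishing of the two middle coefficients. -/
lemma frobenius_powers_coeff_eq_zero {q : ℕ} (hq : 1 < q) {F : Type*} [Field F] [Fintype F]
    (hcard : Fintype.card F = q ^ 6) {a b d e : F}
    (h : ∀ x : F, a * x + b * x ^ q + d * x ^ (q ^ 3) + e * x ^ (q ^ 5) = 0) :
    b = 0 ∧ d = 0 := by
  have h13 : q < q ^ 3 := by simpa using Nat.pow_lt_pow_right hq (show 1 < 3 by norm_num)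
  have h35 : q ^ 3 < q ^ 5 := Nat.pow_lt_pow_right hq (by norm_num)
  have h56 : q ^ 5 < q ^ 6 := Nat.pow_lt_pow_right hq (by norm_num)
  set P : F[X] := C a * X ^ 1 + C b * X ^ q + C d * X ^ (q ^ 3) + C e * X ^ (q ^ 5) with hP
  have hdeg : P.natDegree ≤ q ^ 5 := by
    refine natDegree_add_le_of_degree_le (natDegree_add_le_of_degree_le
      (natDegree_add_le_of_degree_le ?_ ?_) ?_) ?_ <;>
    exact (natDegree_C_mul_X_pow_le _ _).trans (by omega)
  have hzero : P = 0 := by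
    refine eq_zero_of_natDegree_lt_card_of_eval_eq_zero P (f := (id : F → F))
      Function.injective_id (fun x => ?_) (by omega)
    simpa [hP] using h x
  have hcoeff (n : ℕ) : P.coeff n = 0 := by rw [hzero, coeff_zero]
  constructor
  · simpa only [hP, coeff_add, coeff_C_mul, coeff_X_pow, hq.ne', h13.ne, (h13.trans h35).ne,
      if_true, if_false, mul_zero, mul_one, zero_add, add_zero] using hcoeff q
  · have hmid := hcoeff (q ^ 3)
    simp only [hP, coeff_add, coeff_C_mul, coeff_X_pow] at hmid
    rw [if_neg (hq.trans h13).ne', if_neg h13.ne', if_neg h35.ne] at hmid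
    simpa using hmid

theorem stmt13 (q : ℕ) (hq : IsPrimePow q) (hodd : Odd q)
    (F : Type*) [Field F] [Fintype F] (hcard : Fintype.card F = q ^ 6)
    (c : F) (hc : c ^ 2 + c = 1)
    (φ : F → F)
    (hadd : ∀ x y : F, φ (x + y) = φ x + φ y)
    (hsmul : ∀ t x : F, t ^ q = t → φ (t * x) = t * φ x) :
    (∀ α β : F, ∃ α' β' : F, ∀ x : F,
        φ (α * x + β * (x ^ q + x ^ (q ^ 3) + c * x ^ (q ^ 5)))
          = α' * x + β' * (x ^ q + x ^ (q ^ 3) + c * x ^ (q ^ 5)))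
      ↔ ∃ a : F, ∀ x : F, φ x = a * x := by
  have hq1 : 1 < q := hq.one_lt
  constructor
  · intro h
    obtain ⟨a, b, hφ⟩ := h 1 0
    simp only [one_mul, zero_mul, add_zero] at hφ
    by_cases hb : b = 0
    · exact ⟨a, fun x => by simp [hφ, hb]⟩
    exfalso
    have key (α : F) : α ^ q = α ^ (q ^ 3) := by
      obtain ⟨α', β', hα⟩ := h α 0
      have hvanish (x : F) : (a * α - α') * x + (b * α ^ q - β') * x ^ q
          + (b * α ^ (q ^ 3) - β') * x ^ (q ^ 3)
          + (c * (b * α ^ (q ^ 5) - β')) * x ^ (q ^ 5) = 0 := by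
        have hx := hα x
        simp only [zero_mul, add_zero, hφ, mul_pow] at hx
        linear_combination hx
      obtain ⟨h1, h3⟩ := frobenius_powers_coeff_eq_zero hq1 hcard hvanish
      exact mul_left_cancel₀ hb (by linear_combination h1 - h3)
    have hone := (frobenius_powers_coeff_eq_zero (a := 0) (b := 1) (d := -1) (e := 0)
      hq1 hcard fun x => by linear_combination key x).1
    exact one_ne_zero hone
  · rintro ⟨a, ha⟩ α β
    exact ⟨a * α, a * β, fun x => by rw [ha]; ring⟩
end

section
/- Let q be an odd prime power with q ≡ 2 or 3 (mod 5), let c ∈ F_{q^6} satisfy c^2 + c = 1, and let U_c = {(x, x^q + x^{q^3} + c·x^{q^5}) : x ∈ F_{q^6}}. Let s be an integer with 1 ≤ s ≤ 5 and gcd(s, 6) = 1, and let U^{1}_s = {(x, x^{q^s}) : x ∈ F_{q^6}}. Then for every field automorphism σ of F_{q^6} and every bijective additive map φ : F_{q^6} × F_{q^6} → F_{q^6} × F_{q^6} satisfying φ(λ·v) = σ(λ)·φ(v) for all λ ∈ F_{q^6} and all v, one has { F_{q^6}·φ(u) : u ∈ U_c, u ≠ 0 } ≠ { F_{q^6}·w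 : w ∈ U^{1}_s, w ≠ 0 }. (The linear set L_c is not PΓL(2, q^6)-equivalent to the linear set of pseudoregulus type.) -/
open Finset in
/-- A polynomial whose exponents are sums of distinct powers `q ^ i`, `i < 6`, without leading
term, that vanishes on a large set has no nonzero coefficient. -/
theorem coeff_eq_zero_of_vanish {F : Type*} [Field F] {q : ℕ} (hq : 2 ≤ q)
    (A : Finset ℕ → F) (M : Finset F) (hM : ∑ i ∈ range 6, q ^ i ≤ M.card)
    (hA : A (range 6) = 0)
    (h : ∀ m ∈ M, ∑ S ∈ (range 6).powerset, A S * m ^ (∑ i ∈ S, q ^ i) = 0)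
    {S : Finset ℕ} (hS : S ⊆ range 6) : A S = 0 := by
  set P : Polynomial F :=
    ∑ S ∈ (range 6).powerset, Polynomial.C (A S) * Polynomial.X ^ (∑ i ∈ S, q ^ i) with hP
  have hcoeff : P.coeff (∑ i ∈ S, q ^ i) = A S := by
    rw [hP, Polynomial.finsetSum_coeff, Finset.sum_eq_single S]
    · simp
    · intro T _ hTS
      rw [Polynomial.coeff_C_mul_X_pow, if_neg]
      exact fun h => hTS (geomSum_injective hq h).symm
    · simp [hS]
  have hdeg : P.degree < (M.card : WithBot ℕ) := by
    rw [hP, ← Finset.sum_erase (a := range 6) _ (by simp [hA])]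
    refine (Polynomial.degree_sum_le _ _).trans_lt ?_
    rw [Finset.sup_lt_iff (WithBot.bot_lt_coe _)]
    intro T hT
    rw [mem_erase, mem_powerset] at hT
    refine (Polynomial.degree_C_mul_X_pow_le _ _).trans_lt ?_
    refine lt_of_lt_of_le ?_ (WithBot.coe_le_coe.2 hM)
    refine WithBot.coe_lt_coe.2 ?_
    obtain ⟨i, hi, hiT⟩ := Finset.exists_of_ssubset (hT.2.ssubset_of_ne hT.1)
    exact Finset.sum_lt_sum_of_subset hT.2 hi hiT (by positivity) (fun _ _ _ => by positivity)
  have hP0 : P = 0 := Polynomial.eq_zero_of_degree_lt_of_eval_finset_eq_zero M hdeg fun m hm => by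
    rw [hP, Polynomial.eval_finsetSum]
    simpa using h m hm
  rw [← hcoeff, hP0, Polynomial.coeff_zero]

open Finset in
/-- Expansion of the norm of `a + b * m` from `𝔽_{q ^ 6}` to `𝔽_q`. -/
theorem norm_add_mul_expand {F : Type*} [Field F] {q : ℕ}
    (hfrob : ∀ (i : ℕ) (a b : F), (a + b) ^ q ^ i = a ^ q ^ i + b ^ q ^ i) (a b m : F) :
    (a + b * m) ^ (∑ i ∈ range 6, q ^ i) =
      ∑ S ∈ (range 6).powerset, b ^ (∑ i ∈ S, q ^ i) * a ^ (∑ i ∈ range 6 \ S, q ^ i) *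
        m ^ (∑ i ∈ S, q ^ i) := by
  rw [← prod_pow_eq_pow_sum]
  simp_rw [add_comm a, hfrob]
  rw [prod_add]
  refine sum_congr rfl fun S _ => ?_
  rw [prod_pow_eq_pow_sum, prod_pow_eq_pow_sum, mul_pow]
  ring

open Finset in
/-- Each fibre of `x ↦ f x / x` on nonzero elements, together with `0`, is an additive group, so
that its cardinality is `-1` in `F`. -/
theorem sum_comp_div_eq_neg_sum {F : Type*} [Field F] [Fintype F] [DecidableEq F] {p : ℕ}
    [Fact p.Prime] [CharP F p] (f : F →+ F) (G : F → F) :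
    ∑ x ∈ univ.erase 0, G (f x / x) = -∑ m ∈ (univ.erase 0).image (fun x => f x / x), G m := by
  rw [sum_comp G (fun x => f x / x), ← sum_neg_distrib]
  refine sum_congr rfl fun m hm => ?_
  obtain ⟨x, hx, hxm⟩ := mem_image.1 hm
  have hx0 : x ≠ 0 := (mem_erase.1 hx).1
  let H : AddSubgroup F := (f - AddMonoidHom.mulLeft m).ker
  have hH : ∀ y, y ∈ H ↔ f y = m * y := fun y => by
    simp [H, AddMonoidHom.mem_ker, sub_eq_zero]
  have hcard : Nat.card H = #{a ∈ univ.erase (0 : F) | f a / a = m} + 1 := by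
    have : (univ.filter (· ∈ H)) = insert 0 {a ∈ univ.erase (0 : F) | f a / a = m} := by
      ext y
      by_cases hy : y = 0
      · simp [hy, H.zero_mem]
      · simp [hy, hH, div_eq_iff hy]
    rw [← card_insert_of_notMem (a := (0 : F)) (by simp), ← this, Nat.card_eq_fintype_card,
      Fintype.card_subtype]
  have hdvd : p ∣ Nat.card H := by
    obtain ⟨k, hk⟩ : ∃ k, Nat.card H = p ^ k := by
      obtain ⟨n, -, hn⟩ := FiniteField.card F p
      have := H.card_addSubgroup_dvd_card
      rw [Nat.card_eq_fintype_card (α := F), hn] at this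
      obtain ⟨k, -, hk⟩ := (Nat.dvd_prime_pow Fact.out).1 this
      exact ⟨k, hk⟩
    rw [hk]
    refine dvd_pow_self p ?_
    rintro rfl
    have hpos : 0 < #{a ∈ univ.erase (0 : F) | f a / a = m} :=
      card_pos.2 ⟨x, by simp [hx0, hxm]⟩
    rw [hcard, pow_zero] at hk
    omega
  have h0 : (Nat.card H : F) = 0 := (CharP.cast_eq_zero_iff F p _).2 hdvd
  rw [hcard] at h0
  push_cast at h0
  rw [nsmul_eq_mul, eq_neg_of_add_eq_zero_left h0]
  ring

/-- If the expansion coefficients of two norms agree for the subsets `{0}` and `{0, 2}`, then the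
two linear forms are proportional or both monomial. -/
theorem monomial_of_coeff_eq {F : Type*} [Field F] {α β γ δ a₁ c₁ a₂ c₂ : F} {r n e : ℕ}
    (hdet : α * δ - β * γ ≠ 0) (he : e ≠ 0)
    (ha₁ : a₁ = α ^ e) (hc₁ : c₁ = γ ^ e) (hn : e + 1 = n)
    (hαn : (α ^ n) ^ r = α ^ n) (hγn : (γ ^ n) ^ r = γ ^ n)
    (ha₂ : α ^ (1 + r) * a₂ = α ^ n) (hc₂ : γ ^ (1 + r) * c₂ = γ ^ n)
    (h₁ : β * a₁ = δ * c₁) (h₂ : β ^ (1 + r) * a₂ = δ ^ (1 + r) * c₂) :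
    (α = 0 ∧ δ = 0) ∨ (β = 0 ∧ γ = 0) := by
  by_cases hα : α = 0
  · left
    subst hα
    have hγ : γ ≠ 0 := by rintro rfl; simp at hdet
    refine ⟨rfl, ?_⟩
    rw [ha₁, hc₁, zero_pow he, mul_zero] at h₁
    simpa [hγ] using h₁.symm
  by_cases hγ : γ = 0
  · right
    subst hγ
    refine ⟨?_, rfl⟩
    rw [ha₁, hc₁, zero_pow he, mul_zero] at h₁
    simpa [hα] using h₁
  have hPA : (β * γ) * α ^ n = (δ * α) * γ ^ n := by
    rw [← hn, pow_succ, pow_succ, ← ha₁, ← hc₁]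
    linear_combination α * γ * h₁
  have hPA' : (β * γ) ^ r * α ^ n = (δ * α) ^ r * γ ^ n := by
    rw [← hαn, ← hγn, ← mul_pow, ← mul_pow, hPA]
  have hPP : (β * γ) ^ (1 + r) * α ^ n = (δ * α) ^ (1 + r) * γ ^ n := by
    rw [← ha₂, ← hc₂, mul_pow, mul_pow]
    linear_combination γ ^ (1 + r) * α ^ (1 + r) * h₂
  have hA : α ^ n ≠ 0 := pow_ne_zero _ hα
  have hC : γ ^ n ≠ 0 := pow_ne_zero _ hγ
  by_cases hδ : δ = 0
  · have : β = 0 := by simpa [hδ, hγ, hα] using hPA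
    simp [hδ, this] at hdet
  exfalso
  have hQ : (δ * α) ^ (1 + r) ≠ 0 := pow_ne_zero _ (mul_ne_zero hδ hα)
  have hAC : α ^ n = γ ^ n := by
    refine mul_left_cancel₀ (mul_ne_zero hQ hC) ?_
    calc (δ * α) ^ (1 + r) * γ ^ n * α ^ n
        = (β * γ * α ^ n) * ((β * γ) ^ r * α ^ n) := by rw [← hPP]; ring
      _ = (δ * α) ^ (1 + r) * γ ^ n * γ ^ n := by rw [hPA, hPA']; ring
  rw [hAC] at hPA
  have := mul_right_cancel₀ hC hPA
  exact hdet (by linear_combination -this)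

theorem geom_six (q : ℕ) (hq : 1 ≤ q) :
    (q - 1) * ∑ i ∈ Finset.range 6, q ^ i = q ^ 6 - 1 := by
  obtain ⟨k, rfl⟩ := Nat.exists_eq_add_of_le' hq
  refine (Nat.sub_eq_of_eq_add ?_).symm
  simp only [Finset.sum_range_succ, Finset.sum_range_zero, Nat.add_sub_cancel]
  ring

/-- Over `𝔽_{q ^ 6}`, norms to `𝔽_q` are fixed by the powers of the `q`-Frobenius. -/
theorem norm_pow_card_pow {F : Type*} [Field F] [Fintype F] {q : ℕ} (hq : 1 ≤ q)
    (hcard : Fintype.card F = q ^ 6) (x : F) (t : ℕ) :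
    (x ^ ∑ i ∈ Finset.range 6, q ^ i) ^ q ^ t = x ^ ∑ i ∈ Finset.range 6, q ^ i := by
  have hfix : (x ^ ∑ i ∈ Finset.range 6, q ^ i) ^ q = x ^ ∑ i ∈ Finset.range 6, q ^ i := by
    by_cases hx : x = 0
    · have : ∑ i ∈ Finset.range 6, q ^ i ≠ 0 := by
        simp only [Finset.sum_range_succ, Finset.sum_range_zero, pow_zero]; omega
      rw [hx, zero_pow this, zero_pow (by omega)]
    · have : (x ^ ∑ i ∈ Finset.range 6, q ^ i) ^ (q - 1) = 1 := by
        rw [← pow_mul, mul_comm, geom_six q hq, ← hcard]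
        exact FiniteField.pow_card_sub_one_eq_one x hx
      obtain ⟨k, rfl⟩ := Nat.exists_eq_add_of_le' hq
      rw [Nat.add_sub_cancel] at this
      rw [pow_succ, this, one_mul]
  induction t with
  | zero => simp
  | succ t ih => rw [pow_succ, pow_mul, ih, hfix]

/-- The power sum of degree `1 + q` of `f x / x`. -/
theorem sum_div_pow_eq {F : Type*} [Field F] [Fintype F] [DecidableEq F] {q : ℕ} (hq : 3 ≤ q)
    (hcard : Fintype.card F = q ^ 6)
    (hfrob : ∀ (i : ℕ) (a b : F), (a + b) ^ q ^ i = a ^ q ^ i + b ^ q ^ i) (c : F) :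
    ∑ x ∈ Finset.univ.erase (0 : F),
      ((x ^ q + x ^ q ^ 3 + c * x ^ q ^ 5) / x) ^ (1 + q) = -c ^ q := by
  have hpow (i : ℕ) (hi : i ≠ 0) (hi' : i < q ^ 6 - 1) : ∑ x : Fˣ, (x : F) ^ i = 0 := by
    rw [FiniteField.sum_pow_units, hcard, if_neg]
    exact fun h => absurd (Nat.le_of_dvd (Nat.pos_of_ne_zero hi) h) (by omega)
  have hpow0 : ∑ x : Fˣ, (1 : F) = -1 := by
    simpa using FiniteField.sum_pow_units F 0
  have hx6 (x : F) : x ^ q ^ 6 = x := by rw [← hcard, FiniteField.pow_card]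
  have h1 : q ^ 2 = q * q := sq q
  have hs : ∑ x ∈ Finset.univ.erase (0 : F),
      ((x ^ q + x ^ q ^ 3 + c * x ^ q ^ 5) / x) ^ (1 + q) =
      ∑ x : Fˣ, (((x : F) ^ q + (x : F) ^ q ^ 3 + c * (x : F) ^ q ^ 5) / x) ^ (1 + q) := by
    symm
    refine Finset.sum_bij (fun x _ => (x : F)) ?_ ?_ ?_ ?_
    · simp
    · intro a _ b _ h
      exact Units.ext h
    · intro b hb
      exact ⟨Units.mk0 b (by simpa using hb), by simp⟩
    · simp
  have l12 : q + 1 ≤ q ^ 2 := by nlinarith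
  have l23 : q ^ 2 + q ≤ q ^ 3 := by nlinarith
  have l34 : q ^ 3 + q ≤ q ^ 4 := by nlinarith [pow_pos (show 0 < q by omega) 3]
  have l45 : q ^ 4 + q ≤ q ^ 5 := by nlinarith [pow_pos (show 0 < q by omega) 4]
  have l56 : 3 * q ^ 5 ≤ q ^ 6 := by nlinarith [pow_pos (show 0 < q by omega) 5]
  rw [hs]
  have hexp (x : Fˣ) : (((x : F) ^ q + (x : F) ^ q ^ 3 + c * (x : F) ^ q ^ 5) / x) ^ (1 + q) =
      c ^ q * 1 + (x : F) ^ (q ^ 2 - 1) + (x : F) ^ (q ^ 4 - 1) +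
      c ^ q * (x : F) ^ (q ^ 3 - q) + (x : F) ^ (q ^ 3 - q + (q ^ 2 - 1)) +
      (x : F) ^ (q ^ 3 - q + (q ^ 4 - 1)) + c * c ^ q * (x : F) ^ (q ^ 5 - q) +
      c * (x : F) ^ (q ^ 5 - q + (q ^ 2 - 1)) + c * (x : F) ^ (q ^ 5 - q + (q ^ 4 - 1)) := by
    have hx : (x : F) ≠ 0 := x.ne_zero
    generalize (x : F) = x at hx
    have e1 (k : ℕ) (hk : 1 ≤ k) : x ^ k = x ^ (k - 1) * x := by
      rw [← pow_succ, Nat.sub_add_cancel hk]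
    have eq' (k : ℕ) (hk : q ≤ k) : x ^ k = x ^ (k - q) * x ^ q := by
      rw [← pow_add, Nat.sub_add_cancel hk]
    have hf := hfrob 1
    simp only [pow_one] at hf
    have hfq : (x ^ q + x ^ q ^ 3 + c * x ^ q ^ 5) ^ q = x ^ q ^ 2 + x ^ q ^ 4 + c ^ q * x := by
      rw [hf, hf, mul_pow, ← pow_mul, ← pow_mul, ← pow_mul, ← pow_succ, ← pow_succ, hx6, h1]
    rw [div_pow, pow_add, pow_one, hfq, pow_add, pow_one, div_eq_iff (by positivity),
      e1 (q ^ 2) (by omega), e1 (q ^ 4) (by omega), eq' (q ^ 3) (by omega),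
      eq' (q ^ 5) (by omega)]
    simp only [pow_add]
    ring
  simp_rw [hexp, Finset.sum_add_distrib, ← Finset.mul_sum]
  rw [hpow0, hpow _ (by omega) (by omega), hpow _ (by omega) (by omega),
    hpow _ (by omega) (by omega), hpow _ (by omega) (by omega), hpow _ (by omega) (by omega),
    hpow _ (by omega) (by omega), hpow _ (by omega) (by omega), hpow _ (by omega) (by omega)]
  ring

open Finset in
/-- The set of slopes of `U_c` is not the image of the norm-one elements under a projectivity. -/
theorem slopes_not_projective_to_norm_one {F : Type*} [Field F] [Fintype F] {p q : ℕ}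
    [Fact p.Prime] [CharP F p] (hq : 3 ≤ q) (hcard : Fintype.card F = q ^ 6)
    (hfrob : ∀ (i : ℕ) (a b : F), (a + b) ^ q ^ i = a ^ q ^ i + b ^ q ^ i)
    {g : F} (hg : IsPrimitiveRoot g (q ^ 6 - 1)) {c α β γ δ : F} (hc : c ≠ 0)
    (hdet : α * δ - β * γ ≠ 0)
    (h1 : ∀ x : F, x ≠ 0 →
      (α * x + β * (x ^ q + x ^ q ^ 3 + c * x ^ q ^ 5)) ^ (∑ i ∈ range 6, q ^ i) =
      (γ * x + δ * (x ^ q + x ^ q ^ 3 + c * x ^ q ^ 5)) ^ (∑ i ∈ range 6, q ^ i))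
    (h2 : ∀ z : F, z ^ (∑ i ∈ range 6, q ^ i) = 1 → ∃ x : F, x ≠ 0 ∧
      γ * x + δ * (x ^ q + x ^ q ^ 3 + c * x ^ q ^ 5) =
        z * (α * x + β * (x ^ q + x ^ q ^ 3 + c * x ^ q ^ 5))) : False := by
  classical
  have hgeom := geom_six q (by omega)
  have hN : ∑ i ∈ range 6, q ^ i = 1 + q + q ^ 2 + q ^ 3 + q ^ 4 + q ^ 5 := by
    simp [sum_range_succ]
  have hN0 : ∑ i ∈ range 6, q ^ i ≠ 0 := by omega
  have hNlt : 1 + q < ∑ i ∈ range 6, q ^ i := by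
    rw [hN]; have := pow_pos (show 0 < q by omega) 2; omega
  set n := ∑ i ∈ range 6, q ^ i with hn
  have hq6 : 0 < q ^ 6 - 1 := by
    rw [← hgeom]; exact Nat.mul_pos (by omega) (by omega)
  have hnq (t : ℕ) (x : F) : (x ^ n) ^ q ^ t = x ^ n :=
    norm_pow_card_pow (by omega) hcard x t
  let f : F →+ F :=
    { toFun := fun x => x ^ q + x ^ q ^ 3 + c * x ^ q ^ 5
      map_zero' := by
        have : q ≠ 0 := by omega
        simp [this]
      map_add' := fun x y => by
        have := hfrob 1 x y
        simp only [pow_one] at this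
        simp only [this, hfrob]
        ring }
  have hf (x : F) : f x = x ^ q + x ^ q ^ 3 + c * x ^ q ^ 5 := rfl
  simp only [← hf] at h1 h2
  set M : Finset F := (univ.erase 0).image (fun x => f x / x) with hM
  have hden (m : F) (h : α + β * m = 0) : γ + δ * m ≠ 0 := fun h' => by
    have e1 : α * δ - β * γ = 0 := by linear_combination δ * h - β * h'
    exact hdet e1
  have hscale (x : F) (hx : x ≠ 0) (a b : F) : a * x + b * f x = x * (a + b * (f x / x)) := by
    field_simp
  have hM1 (m : F) (hm : m ∈ M) : (α + β * m) ^ n = (γ + δ * m) ^ n := by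
    obtain ⟨x, hx, rfl⟩ := mem_image.1 hm
    have hx0 : x ≠ 0 := (mem_erase.1 hx).1
    have := h1 x hx0
    rw [hscale x hx0, hscale x hx0, mul_pow, mul_pow] at this
    exact mul_left_cancel₀ (pow_ne_zero _ hx0) this
  have hMden (m : F) (hm : m ∈ M) : α + β * m ≠ 0 := fun h => by
    have := hM1 m hm
    rw [h, zero_pow hN0] at this
    exact hden m h (pow_eq_zero_iff hN0 |>.1 this.symm)
  have hZM (z : F) (hz : z ^ n = 1) : ∃ m ∈ M, γ + δ * m = z * (α + β * m) := by
    obtain ⟨x, hx, hxz⟩ := h2 z hz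
    refine ⟨f x / x, mem_image.2 ⟨x, by simp [hx], rfl⟩, ?_⟩
    rw [hscale x hx, hscale x hx, mul_left_comm] at hxz
    exact mul_left_cancel₀ hx hxz
  have hM2 (m : F) (h : (α + β * m) ^ n = (γ + δ * m) ^ n) : m ∈ M := by
    have ha : α + β * m ≠ 0 := fun h0 => by
      rw [h0, zero_pow hN0] at h
      exact hden m h0 (pow_eq_zero_iff hN0 |>.1 h.symm)
    obtain ⟨m', hm', hz⟩ := hZM ((γ + δ * m) / (α + β * m)) (by
      rw [div_pow, h, div_self]
      rw [← h]; exact pow_ne_zero _ ha)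
    have : (α * δ - β * γ) * (m' - m) = 0 := by
      rw [div_mul_eq_mul_div, eq_div_iff ha] at hz
      linear_combination hz
    rcases mul_eq_zero.1 this with h0 | h0
    · exact absurd h0 hdet
    · rwa [← sub_eq_zero.1 h0]
  have hcardM : n ≤ M.card := by
    have hζ : IsPrimitiveRoot (g ^ (q - 1)) n := hg.pow hq6 hgeom.symm
    rw [← hζ.card_nthRootsFinset]
    refine (card_le_card ?_).trans (card_image_le (s := M)
      (f := fun m => (γ + δ * m) / (α + β * m)))
    intro z hz
    rw [Polynomial.mem_nthRootsFinset (by omega)] at hz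
    obtain ⟨m, hm, h⟩ := hZM z hz
    exact mem_image.2 ⟨m, hm, by rw [div_eq_iff (hMden m hm), h]⟩
  -- a symmetry of `M`
  obtain ⟨l, hl0, hl, hl2⟩ : ∃ l : F, l ≠ 0 ∧ l ^ q ^ 2 = l ∧ (l ^ (q - 1)) ^ 2 ≠ 1 := by
    have hfac : q ^ 6 - 1 = (q ^ 4 + q ^ 2 + 1) * (q ^ 2 - 1) := by
      have : 1 ≤ q ^ 2 := Nat.one_le_pow _ _ (by omega)
      obtain ⟨k, hk⟩ := Nat.exists_eq_add_of_le' this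
      rw [hk, show q ^ 6 = (q ^ 2) ^ 3 by ring, show q ^ 4 = (q ^ 2) ^ 2 by ring, hk]
      refine Nat.sub_eq_of_eq_add ?_
      simp only [Nat.add_sub_cancel]
      ring
    have hl := hg.pow hq6 hfac
    have hq2 : 1 ≤ q ^ 2 := Nat.one_le_pow _ _ (by omega)
    refine ⟨g ^ (q ^ 4 + q ^ 2 + 1), pow_ne_zero _ (hg.ne_zero hq6.ne'), ?_, ?_⟩
    · calc (g ^ (q ^ 4 + q ^ 2 + 1)) ^ q ^ 2
          = (g ^ (q ^ 4 + q ^ 2 + 1)) ^ (q ^ 2 - 1 + 1) := by rw [Nat.sub_add_cancel hq2]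
        _ = _ := by rw [pow_succ, hl.pow_eq_one, one_mul]
    · rw [← pow_mul]
      have : 3 * q ≤ q ^ 2 := by nlinarith
      exact hl.pow_ne_one_of_pos_of_lt (by omega) (by omega)
  set μ := l ^ (q - 1) with hμ
  have hlq : l ^ q = μ * l := by rw [hμ, ← pow_succ, Nat.sub_add_cancel (by omega)]
  have hl3 : l ^ q ^ 3 = l ^ q := by rw [pow_succ q 2, pow_mul, hl]
  have hl5 : l ^ q ^ 5 = l ^ q := by rw [show q ^ 5 = q ^ 2 * q ^ 3 by ring, pow_mul, hl, hl3]
  have hμ1 : μ ≠ 1 := fun h => hl2 (by rw [h, one_pow])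
  have hμq2 : μ ^ q ^ 2 = μ := by rw [hμ, ← pow_mul, mul_comm, pow_mul, hl]
  have hμn : μ ^ n = 1 := by
    rw [hμ, ← pow_mul, hgeom, ← hcard]
    exact FiniteField.pow_card_sub_one_eq_one l hl0
  have hμM (m : F) (hm : m ∈ M) : μ * m ∈ M := by
    obtain ⟨x, hx, rfl⟩ := mem_image.1 hm
    have hx0 : x ≠ 0 := (mem_erase.1 hx).1
    refine mem_image.2 ⟨l * x, by simp [hl0, hx0], ?_⟩
    have : f (l * x) = μ * l * f x := by
      rw [hf, hf, mul_pow, mul_pow, mul_pow, hl5, hl3, hlq]; ring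
    simp only [this]
    field_simp
  -- comparing coefficients
  have hcoeff (S : Finset ℕ) (hS : S ⊆ range 6) (hμS : μ ^ (∑ i ∈ S, q ^ i) ≠ 1) :
      β ^ (∑ i ∈ S, q ^ i) * α ^ (∑ i ∈ range 6 \ S, q ^ i) =
      δ ^ (∑ i ∈ S, q ^ i) * γ ^ (∑ i ∈ range 6 \ S, q ^ i) := by
    have := coeff_eq_zero_of_vanish (q := q) (by omega)
      (fun S => (β ^ (∑ i ∈ S, q ^ i) * α ^ (∑ i ∈ range 6 \ S, q ^ i) -
        δ ^ (∑ i ∈ S, q ^ i) * γ ^ (∑ i ∈ range 6 \ S, q ^ i)) *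
        (μ ^ (∑ i ∈ S, q ^ i) - 1)) M hcardM
      (by simp only [← hn, hμn, sub_self, mul_zero]) (fun m hm => by
        have e1 := hM1 m hm
        have e2 := hM1 _ (hμM m hm)
        rw [hn, norm_add_mul_expand hfrob, norm_add_mul_expand hfrob, ← sub_eq_zero,
          ← sum_sub_distrib] at e1 e2
        rw [← sub_eq_zero.2 (e2.trans e1.symm), ← sum_sub_distrib]
        refine sum_congr rfl fun S _ => ?_
        rw [mul_pow]
        ring) hS
    exact sub_eq_zero.1 ((mul_eq_zero.1 this).resolve_right (sub_ne_zero.2 hμS))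
  have hmon : (α = 0 ∧ δ = 0) ∨ (β = 0 ∧ γ = 0) := by
    have k1 := hcoeff {0} (by decide) (by simpa using hμ1)
    have k2 := hcoeff {0, 2} (by decide) (by
      rw [sum_pair (by decide), pow_zero, pow_add, hμq2, pow_one, ← sq]; exact hl2)
    have hsplit : q ^ 0 + q ^ 2 + ∑ i ∈ range 6 \ {0, 2}, q ^ i = n := by
      rw [← sum_pair (f := fun i => q ^ i) (show (0 : ℕ) ≠ 2 by decide), add_comm]
      exact sum_sdiff (by decide)
    have hsplit1 : ∑ i ∈ range 6 \ {0}, q ^ i + 1 = n := by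
      rw [hn, ← sum_sdiff (show ({0} : Finset ℕ) ⊆ range 6 by decide)]; simp
    rw [sum_singleton, pow_zero, pow_one, pow_one] at k1
    rw [sum_pair (by decide), pow_zero] at k2
    rw [pow_zero] at hsplit
    exact monomial_of_coeff_eq hdet (by omega) rfl rfl hsplit1 (hnq 2 α) (hnq 2 γ)
      (by rw [← pow_add, hsplit]) (by rw [← pow_add, hsplit]) k1 k2
  have hinv (ζ : F) (hζ : ζ ^ n = 1) (m : F) (hm : m ∈ M) : ζ * m ∈ M := by
    have := hM1 m hm
    apply hM2
    rcases hmon with ⟨rfl, rfl⟩ | ⟨rfl, rfl⟩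
    · simpa [mul_pow, hζ] using this
    · simpa [mul_pow, hζ] using this
  have hζ : IsPrimitiveRoot (g ^ (q - 1)) n := hg.pow hq6 hgeom.symm
  set ζ := g ^ (q - 1)
  have hζ0 : ζ ≠ 0 := hζ.ne_zero hN0
  have hζd : ζ ^ (1 + q) ≠ 1 := hζ.pow_ne_one_of_pos_of_lt (by omega) hNlt
  have himage : M.image (ζ * ·) = M := by
    refine eq_of_subset_of_card_le ?_ ?_
    · intro y hy
      obtain ⟨m, hm, rfl⟩ := mem_image.1 hy
      exact hinv ζ hζ.pow_eq_one m hm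
    · rw [card_image_of_injective _ (mul_right_injective₀ hζ0)]
  have hsum : ∑ m ∈ M, m ^ (1 + q) = 0 := by
    have : ∑ m ∈ M, m ^ (1 + q) = ζ ^ (1 + q) * ∑ m ∈ M, m ^ (1 + q) := by
      conv_lhs => rw [← himage]
      rw [sum_image (fun _ _ _ _ h => mul_right_injective₀ hζ0 h), mul_sum]
      simp [mul_pow]
    have h0 : (ζ ^ (1 + q) - 1) * ∑ m ∈ M, m ^ (1 + q) = 0 := by linear_combination -this
    exact (mul_eq_zero.1 h0).resolve_left (sub_ne_zero.2 hζd)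
  have hfin : ∑ x ∈ univ.erase 0, (f x / x) ^ (1 + q) = -∑ m ∈ M, m ^ (1 + q) :=
    sum_comp_div_eq_neg_sum (p := p) f (fun m => m ^ (1 + q))
  rw [hsum, neg_zero] at hfin
  simp only [hf] at hfin
  rw [sum_div_pow_eq hq hcard hfrob c, neg_eq_zero] at hfin
  exact pow_ne_zero _ hc hfin

open Finset in
/-- Over `𝔽_{q ^ 6}`, an element has norm `1` over `𝔽_q` iff it is a `(q ^ s - 1)`-th power,
for `s` coprime to `6`. -/
theorem exists_pow_eq_mul_of_norm_one {F : Type*} [Field F] [Fintype F] {q : ℕ} (hq : 3 ≤ q)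
    (hcard : Fintype.card F = q ^ 6) {g : F} (hg : IsPrimitiveRoot g (q ^ 6 - 1)) {s : ℕ}
    (hs : s = 1 ∨ s = 5) {z : F} (hz : z ^ (∑ i ∈ range 6, q ^ i) = 1) :
    ∃ w : F, w ≠ 0 ∧ w ^ q ^ s = z * w := by
  have hgeom := geom_six q (by omega)
  have hN0 : ∑ i ∈ range 6, q ^ i ≠ 0 := by
    simp only [sum_range_succ, sum_range_zero, pow_zero]; omega
  have hq6 : 0 < q ^ 6 - 1 := by
    rw [← hgeom]; exact Nat.mul_pos (by omega) (by omega)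
  have : NeZero (∑ i ∈ range 6, q ^ i) := ⟨hN0⟩
  obtain ⟨i, -, hi⟩ := (hg.pow hq6 hgeom.symm).eq_pow_of_pow_eq_one hz
  have hg0 : g ≠ 0 := hg.ne_zero hq6.ne'
  set v := g ^ i with hv
  have hv0 : v ≠ 0 := pow_ne_zero _ hg0
  have hvz : v ^ q = z * v := by
    have hzv : z = v ^ (q - 1) := by rw [← hi, hv, pow_right_comm]
    rw [hzv, ← pow_succ, Nat.sub_add_cancel (by omega)]
  have hz0 : z ≠ 0 := by
    rintro rfl
    rw [zero_pow hN0] at hz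
    exact zero_ne_one hz
  rcases hs with rfl | rfl
  · exact ⟨v, hv0, by rw [pow_one, hvz]⟩
  · refine ⟨(v⁻¹) ^ q, pow_ne_zero _ (inv_ne_zero hv0), ?_⟩
    rw [← pow_mul, ← pow_succ', ← hcard, FiniteField.pow_card, inv_pow, hvz]
    field_simp

theorem stmt15 (q : ℕ) (hq : IsPrimePow q) (hodd : Odd q)
    (hq5 : q % 5 = 2 ∨ q % 5 = 3)
    (F : Type*) [Field F] [Fintype F] (hcard : Fintype.card F = q ^ 6)
    (c : F) (hc : c ^ 2 + c = 1)
    (Uc : Set (F × F))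
    (hUc : Uc = {p : F × F | ∃ x : F, p = (x, x ^ q + x ^ (q ^ 3) + c * x ^ (q ^ 5))})
    (s : ℕ) (hs1 : 1 ≤ s) (hs5 : s ≤ 5) (hsgcd : Nat.gcd s 6 = 1)
    (U1 : Set (F × F))
    (hU1 : U1 = {p : F × F | ∃ x : F, p = (x, x ^ (q ^ s))}) :
    ∀ (σ : F ≃+* F) (φ : F × F → F × F),
      Function.Bijective φ →
      (∀ v w : F × F, φ (v + w) = φ v + φ w) →
      (∀ (l : F) (v : F × F), φ (l • v) = σ l • φ v) →
      ({W : Submodule F (F × F) | ∃ u ∈ Uc, u ≠ 0 ∧ W = Submodule.span F {φ u}} :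
          Set (Submodule F (F × F)))
        ≠ {W : Submodule F (F × F) | ∃ w ∈ U1, w ≠ 0 ∧ W = Submodule.span F {w}} := by
  intro σ φ hbij hadd hsmul heq
  have hq3 : 3 ≤ q := by
    obtain ⟨k, hk⟩ := hodd
    omega
  obtain ⟨p, hp⟩ := CharP.exists F
  obtain ⟨N, hpp, hN⟩ := FiniteField.card F p
  have : Fact p.Prime := ⟨hpp⟩
  obtain ⟨k, rfl⟩ : ∃ k, q = p ^ k := by
    have hdvd : q ∣ p ^ (N : ℕ) := by
      rw [← hN, hcard]
      exact dvd_pow_self q (by norm_num)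
    obtain ⟨k, -, hk⟩ := (Nat.dvd_prime_pow hpp).1 hdvd
    exact ⟨k, hk⟩
  have hfrob (i : ℕ) (a b : F) : (a + b) ^ (p ^ k) ^ i = a ^ (p ^ k) ^ i + b ^ (p ^ k) ^ i := by
    rw [← pow_mul]
    exact add_pow_char_pow a b p (k * i)
  set q := p ^ k
  obtain ⟨g, hg⟩ : ∃ g : F, IsPrimitiveRoot g (q ^ 6 - 1) := by
    obtain ⟨u, hu⟩ := IsCyclic.exists_ofOrder_eq_natCard (α := Fˣ)
    refine ⟨u, ?_⟩
    rw [← hcard, ← Nat.card_eq_fintype_card, ← Nat.card_units, ← hu]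
    exact IsPrimitiveRoot.coe_units_iff.2 (IsPrimitiveRoot.orderOf u)
  have hs : s = 1 ∨ s = 5 := by
    interval_cases s <;> simp_all
  have hc0 : c ≠ 0 := by
    rintro rfl
    simp at hc
  set α := (φ (1, 0)).1 with hα
  set γ := (φ (1, 0)).2 with hγ
  set β := (φ (0, 1)).1 with hβ
  set δ := (φ (0, 1)).2 with hδ
  have hφ (x y : F) : φ (x, y) = (α * σ x + β * σ y, γ * σ x + δ * σ y) := by
    have : ((x, y) : F × F) = x • (1, 0) + y • (0, 1) := by ext <;> simp
    rw [this, hadd, hsmul, hsmul]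
    ext
    · simp [hα, hβ, mul_comm]
    · simp [hγ, hδ, mul_comm]
  have hφ0 : φ 0 = 0 := by simpa using hadd 0 0
  have hdet : α * δ - β * γ ≠ 0 := by
    intro h0
    have hker (a b : F) (h1 : α * a + β * b = 0) (h2 : γ * a + δ * b = 0) : a = 0 ∧ b = 0 := by
      have : φ (σ.symm a, σ.symm b) = φ 0 := by
        rw [hφ, hφ0]
        simp [h1, h2]
      simpa using hbij.1 this
    have k1 := hker δ (-γ) (by linear_combination h0) (by ring)
    have k2 := hker β (-α) (by ring) (by linear_combination -h0)
    have k3 := hker 1 0 (by linear_combination -k2.2) (by linear_combination -k1.2)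
    exact one_ne_zero k3.1
  have hnorm (x : F) : (x ^ q ^ s) ^ (∑ i ∈ Finset.range 6, q ^ i) =
      x ^ (∑ i ∈ Finset.range 6, q ^ i) := by
    rw [← pow_mul, mul_comm, pow_mul, norm_pow_card_pow (by omega) hcard]
  have hfσ (x : F) : σ (x ^ q + x ^ q ^ 3 + c * x ^ q ^ 5) =
      σ x ^ q + σ x ^ q ^ 3 + σ c * σ x ^ q ^ 5 := by simp
  refine slopes_not_projective_to_norm_one (p := p) hq3 hcard hfrob hg (c := σ c)
    (by simpa using hc0) hdet ?_ ?_
  · intro x hx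
    obtain ⟨x, rfl⟩ := σ.surjective x
    have hx0 : x ≠ 0 := by simpa using hx
    have hmem : Submodule.span F {φ (x, x ^ q + x ^ q ^ 3 + c * x ^ q ^ 5)} ∈
        {W : Submodule F (F × F) | ∃ w ∈ U1, w ≠ 0 ∧ W = Submodule.span F {w}} := by
      rw [← heq]
      exact ⟨_, by rw [hUc]; exact ⟨x, rfl⟩, by simp [hx0], rfl⟩
    obtain ⟨w, hw, -, hspan⟩ := hmem
    rw [hU1] at hw
    obtain ⟨y, rfl⟩ := hw
    have hin : φ (x, x ^ q + x ^ q ^ 3 + c * x ^ q ^ 5) ∈ Submodule.span F {(y, y ^ q ^ s)} :=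
      hspan ▸ Submodule.mem_span_singleton_self _
    obtain ⟨t, ht⟩ := Submodule.mem_span_singleton.1 hin
    rw [hφ, hfσ, Prod.smul_mk, Prod.mk.injEq] at ht
    rw [← ht.1, ← ht.2, smul_eq_mul, smul_eq_mul, mul_pow, mul_pow, hnorm]
  · intro z hz
    obtain ⟨w, hw0, hw⟩ := exists_pow_eq_mul_of_norm_one hq3 hcard hg hs hz
    have hmem : Submodule.span F {(w, w ^ q ^ s)} ∈
        {W : Submodule F (F × F) | ∃ u ∈ Uc, u ≠ 0 ∧ W = Submodule.span F {φ u}} := by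
      rw [heq]
      exact ⟨_, by rw [hU1]; exact ⟨w, rfl⟩, by simp [hw0], rfl⟩
    obtain ⟨u, hu, hu0, hspan⟩ := hmem
    rw [hUc] at hu
    obtain ⟨x, rfl⟩ := hu
    have hin : φ (x, x ^ q + x ^ q ^ 3 + c * x ^ q ^ 5) ∈ Submodule.span F {(w, w ^ q ^ s)} :=
      hspan ▸ Submodule.mem_span_singleton_self _
    obtain ⟨t, ht⟩ := Submodule.mem_span_singleton.1 hin
    rw [hφ, hfσ, Prod.smul_mk, Prod.mk.injEq, hw, smul_eq_mul, smul_eq_mul] at ht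
    refine ⟨σ x, ?_, ?_⟩
    · rw [map_ne_zero]
      rintro rfl
      have : q ≠ 0 := by omega
      simp [this] at hu0
    · rw [← ht.1, ← ht.2]
      ring
end
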